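/- arXiv:1401.2042 — 2 statements merged into one kernel-verified Lean document; each statement's English description precedes it below -/
import Mathlib

section
/- Let ρ̃ be a finite positive Borel measure on ℝ with compact support contained in [0,∞), with ρ̃({0}) = 0 and ρ̃(ℝ) ≤ 1. In the Hilbert space L²(ℝ, dρ̃), let H₀ be the (bounded, positive, injective) operator of multiplication by √x, let 𝟙 denote the constant function 1, and let H = (H₀² − ⟨·, H₀𝟙⟩H₀𝟙)^{1/2}, which is well defined since the Cauchy–Schwarz inequality and ρ̃(ℝ) ≤ 1 give H₀² − ⟨·, H₀𝟙⟩H₀𝟙 ≥ 0. Then there exists a contraction Σ₀ on L²(ℝ, dρ̃) with Σ₀H₀ = H, and for any contraction Σ₀ satisfying Σ₀H₀ = H one has ‖Σ₀ⁿ f‖ → 0 as n → ∞ for every f ∈ L²(ℝ, dρ̃). -/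
open MeasureTheory
open scoped ComplexInnerProductSpace

/-- A convex sequence of reals that is bounded above is antitone. -/
lemma antitone_of_convex_of_bddAbove {a : ℕ → ℝ} {M : ℝ}
    (hconv : ∀ k, 2 * a (k + 1) ≤ a k + a (k + 2)) (hM : ∀ k, a k ≤ M) : Antitone a := by
  refine antitone_nat_of_succ_le fun k => ?_
  by_contra! hk
  set d := a (k + 1) - a k with hd
  have hdpos : 0 < d := sub_pos.2 hk
  have hstep : ∀ j, d ≤ a (k + j + 1) - a (k + j) := by
    intro j
    induction j with
    | zero => exact hd.le
    | succ j ih =>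
      have := hconv (k + j)
      simp only [← add_assoc] at this ⊢
      linarith
  have hlin : ∀ j : ℕ, a k + j * d ≤ a (k + j) := by
    intro j
    induction j with
    | zero => simp
    | succ j ih =>
      have := hstep j
      push_cast
      rw [← add_assoc]
      linarith
  obtain ⟨j, hj⟩ := exists_nat_gt ((M - a k) / d)
  rw [div_lt_iff₀ hdpos] at hj
  linarith [hlin j, hM (k + j)]

section Hilbert

variable {E : Type*} [NormedAddCommGroup E] [InnerProductSpace ℂ E]

/-- A sequence whose Gram matrix is a Hankel matrix with convergent entries is Cauchy. -/
lemma cauchySeq_of_re_inner_eq_add {u : ℕ → E} {a : ℕ → ℝ} {l : ℝ}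
    (hu : ∀ m n, RCLike.re ⟪u m, u n⟫ = a (m + n))
    (ha : Filter.Tendsto a Filter.atTop (nhds l)) : CauchySeq u := by
  rw [Metric.cauchySeq_iff']
  intro ε hε
  obtain ⟨N, hN⟩ := Metric.tendsto_atTop.1 ha (ε ^ 2 / 4) (by positivity)
  refine ⟨N, fun n hn => ?_⟩
  have hsq : dist (u n) (u N) ^ 2 = a (n + n) - 2 * a (n + N) + a (N + N) := by
    rw [dist_eq_norm, norm_sub_sq (𝕜 := ℂ), ← inner_self_eq_norm_sq (𝕜 := ℂ) (u n),
      ← inner_self_eq_norm_sq (𝕜 := ℂ) (u N), hu, hu, hu]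
  have h₁ := abs_lt.1 (hN (n + n) (by omega))
  have h₂ := abs_lt.1 (hN (n + N) (by omega))
  have h₃ := abs_lt.1 (hN (N + N) (by omega))
  refine lt_of_pow_lt_pow_left₀ 2 hε.le ?_
  rw [hsq]
  linarith [h₁.2, h₂.1, h₃.2]

lemma norm_pow_apply_le_of_norm_le_one {T : E →L[ℂ] E} (hT : ‖T‖ ≤ 1) (n : ℕ) (x : E) :
    ‖(T ^ n) x‖ ≤ ‖x‖ := by
  induction n with
  | zero => simp
  | succ n ih =>
    rw [pow_succ', mul_apply_eq_comp]
    exact ((T.le_of_opNorm_le hT _).trans_eq (one_mul _)).trans ih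

variable [CompleteSpace E]

/-- A vector fixed by a Hilbert space contraction is fixed by its adjoint. -/
lemma adjoint_apply_eq_self_of_apply_eq_self {T : E →L[ℂ] E} (hT : ‖T‖ ≤ 1) {x : E}
    (hx : T x = x) : T.adjoint x = x := by
  have hle : ‖T.adjoint x‖ ≤ ‖x‖ :=
    T.adjoint.le_of_opNorm_le_of_le ((LinearIsometryEquiv.norm_map _ T).trans_le hT) le_rfl
      |>.trans_eq (one_mul _)
  have hin : RCLike.re ⟪T.adjoint x, x⟫ = ‖x‖ ^ 2 := by
    rw [ContinuousLinearMap.adjoint_inner_left, hx, inner_self_eq_norm_sq]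
  have hsq : ‖T.adjoint x - x‖ ^ 2 ≤ 0 := by
    rw [norm_sub_sq (𝕜 := ℂ), hin]
    nlinarith [norm_nonneg (T.adjoint x)]
  exact sub_eq_zero.1 (norm_eq_zero.1 (pow_eq_zero_iff two_ne_zero |>.1
    (le_antisymm hsq (sq_nonneg _))))

lemma denseRange_of_isSelfAdjoint_of_injective {A : E →L[ℂ] E} (hA : IsSelfAdjoint A)
    (hinj : ∀ x, A x = 0 → x = 0) : DenseRange A := by
  have h : A.rangeᗮ = ⊥ := by
    rw [ContinuousLinearMap.orthogonal_range, ← ContinuousLinearMap.star_eq_adjoint, hA.star_eq]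
    exact (Submodule.eq_bot_iff _).2 fun x hx => hinj x hx
  have h' := (Submodule.topologicalClosure_eq_top_iff).2 h
  rw [← Submodule.dense_iff_topologicalClosure_eq_top] at h'
  exact h'

lemma mul_adjoint_eq_of_mul_eq {A H T : E →L[ℂ] E} (hA : IsSelfAdjoint A)
    (hH : IsSelfAdjoint H) (hTA : T * A = H) : A * T.adjoint = H := by
  have := congrArg star hTA
  rwa [star_mul, hA.star_eq, hH.star_eq, ContinuousLinearMap.star_eq_adjoint] at this

/-- If `T` is a contraction with `T * A = H` for positive operators `A` and `H`, then the powers of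
`T` converge on the range of `A`. -/
lemma cauchySeq_pow_apply_of_mul_eq {A H T : E →L[ℂ] E} (hA : A.IsPositive) (hH : H.IsPositive)
    (hT : ‖T‖ ≤ 1) (hTA : T * A = H) (f : E) : CauchySeq fun n => (T ^ n) (A f) := by
  set R := T.adjoint with hR
  have hRnorm : ‖R‖ ≤ 1 := (LinearIsometryEquiv.norm_map _ T).trans_le hT
  have hARx : ∀ x, A (R x) = H x := fun x =>
    DFunLike.congr_fun (mul_adjoint_eq_of_mul_eq hA.isSelfAdjoint hH.isSelfAdjoint hTA) x
  have hTAx : ∀ x, T (A x) = H x := fun x => DFunLike.congr_fun hTA x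
  have hRs : ∀ n, (R ^ (n + 1)) f = R ((R ^ n) f) := fun n => by
    rw [pow_succ', mul_apply_eq_comp]
  have hshift : ∀ m n, ⟪A ((R ^ (m + 1)) f), (R ^ n) f⟫ = ⟪A ((R ^ m) f), (R ^ (n + 1)) f⟫ := by
    intro m n
    rw [hRs, hRs, hARx, hH.inner_left_eq_inner_right, hA.inner_left_eq_inner_right, hARx]
  set a : ℕ → ℝ := fun k => RCLike.re ⟪A ((R ^ k) f), f⟫ with ha
  have hgram : ∀ n m, RCLike.re ⟪A ((R ^ m) f), (R ^ n) f⟫ = a (m + n) := by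
    intro n
    induction n with
    | zero => intro m; simp [ha]
    | succ n ih => intro m; rw [← hshift, ih]; congr 1; omega
  have hbound : ∀ k, |a k| ≤ ‖A‖ * ‖f‖ * ‖f‖ := fun k =>
    (RCLike.abs_re_le_norm _).trans ((norm_inner_le_norm _ _).trans (by
      gcongr
      exact A.le_of_opNorm_le_of_le le_rfl (norm_pow_apply_le_of_norm_le_one hRnorm k f)))
  have hconv : ∀ k, 2 * a (k + 1) ≤ a k + a (k + 2) := by
    intro k
    obtain ⟨m, rfl | rfl⟩ := Nat.even_or_odd' k
    · have h := hA.re_inner_nonneg_left ((R ^ m) f - (R ^ (m + 1)) f)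
      simp only [map_sub, inner_sub_left, inner_sub_right, hgram] at h
      ring_nf at h ⊢
      linarith
    · have h := hH.re_inner_nonneg_left ((R ^ m) f - (R ^ (m + 1)) f)
      simp only [map_sub, inner_sub_left, inner_sub_right, ← hARx, ← hRs, hgram] at h
      ring_nf at h ⊢
      linarith
  have hlim := tendsto_atTop_ciInf
    (antitone_of_convex_of_bddAbove hconv fun k => (abs_le.1 (hbound k)).2)
    ⟨-(‖A‖ * ‖f‖ * ‖f‖), by rintro _ ⟨k, rfl⟩; exact (abs_le.1 (hbound k)).1⟩
  set S := CFC.sqrt A with hS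
  have hSS : S * S = A := CFC.sqrt_mul_sqrt_self A (A.nonneg_iff_isPositive.2 hA)
  have hSpos : S.IsPositive := S.nonneg_iff_isPositive.1 (CFC.sqrt_nonneg A)
  have hSSx : ∀ x, S (S x) = A x := fun x => DFunLike.congr_fun hSS x
  have hcauchy : CauchySeq fun n => S ((R ^ n) f) := by
    refine cauchySeq_of_re_inner_eq_add (fun m n => ?_) hlim
    rw [← hSpos.inner_left_eq_inner_right, hSSx, hgram]
  have hinter : ∀ n, (T ^ n) (A f) = S (S ((R ^ n) f)) := by
    intro n
    rw [hSSx]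
    induction n with
    | zero => simp
    | succ n ih => rw [hRs, hARx, pow_succ', mul_apply_eq_comp, ih, hTAx]
  simp only [hinter]
  exact hcauchy.map S.uniformContinuous

/-- Let `A` be positive and injective, `H` positive with `H ^ 2 = A ^ 2 - ⟪A v, ·⟫ A v`, and
`v` cyclic for `A ^ 2`. Then any contraction `T` with `T * A = H` is strongly stable. -/
lemma tendsto_pow_apply_of_rank_one_perturbation {A H T : E →L[ℂ] E} (hA : A.IsPositive)
    (hinj : ∀ x, A x = 0 → x = 0) (hH : H.IsPositive) {v : E}
    (hH2 : ∀ f, (H ^ 2) f = (A ^ 2) f - ⟪A v, f⟫ • A v)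
    (hcyc : ∀ g, (∀ n : ℕ, ⟪v, (A ^ (2 * n)) g⟫ = 0) → g = 0)
    (hT : ‖T‖ ≤ 1) (hTA : T * A = H) (f : E) :
    Filter.Tendsto (fun n => (T ^ n) f) Filter.atTop (nhds 0) := by
  have hdense : DenseRange A := denseRange_of_isSelfAdjoint_of_injective hA.isSelfAdjoint hinj
  have hTAx : ∀ x, T (A x) = H x := fun x => DFunLike.congr_fun hTA x
  have hAT : ∀ x, A (T.adjoint x) = H x := fun x =>
    DFunLike.congr_fun (mul_adjoint_eq_of_mul_eq hA.isSelfAdjoint hH.isSelfAdjoint hTA) x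
  have hdefect : ∀ x, T.adjoint (T x) = x - ⟪v, x⟫ • v := by
    intro x
    refine hdense.induction_on (p := fun x => T.adjoint (T x) = x - ⟪v, x⟫ • v) x ?_ ?_
    · exact isClosed_eq (by fun_prop) (by fun_prop)
    · intro x
      refine sub_eq_zero.1 (hinj _ ?_)
      rw [map_sub, hAT, hTAx, ← mul_apply_eq_comp, ← pow_two, hH2, map_sub, map_smul,
        pow_two, mul_apply_eq_comp, hA.inner_left_eq_inner_right, sub_self]
  have hfix : ∀ h, T h = h → h = 0 := by
    intro h hh
    have hortho : ∀ h, T h = h → ⟪v, h⟫ = 0 := by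
      intro h hh
      have h₁ := hdefect h
      rw [hh, adjoint_apply_eq_self_of_apply_eq_self hT hh, eq_comm, sub_eq_self,
        smul_eq_zero] at h₁
      rcases h₁ with h₁ | h₁
      · exact h₁
      · rw [h₁, inner_zero_left]
    have hstable : ∀ n : ℕ, T ((A ^ n) h) = (A ^ n) h := by
      intro n
      induction n with
      | zero => simpa using hh
      | succ n ih =>
        rw [pow_succ', mul_apply_eq_comp, hTAx, ← hAT,
          adjoint_apply_eq_self_of_apply_eq_self hT ih]
    exact hcyc h fun n => hortho _ (hstable _)
  have hrange : ∀ x, Filter.Tendsto (fun n => (T ^ n) (A x)) Filter.atTop (nhds 0) := by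
    intro x
    obtain ⟨h, hh⟩ := cauchySeq_tendsto_of_complete (cauchySeq_pow_apply_of_mul_eq hA hH hT hTA x)
    have h₁ : Filter.Tendsto (fun n => (T ^ (n + 1)) (A x)) Filter.atTop (nhds (T h)) := by
      simp only [pow_succ', mul_apply_eq_comp]
      exact (T.continuous.tendsto h).comp hh
    have h₂ := tendsto_nhds_unique h₁ ((Filter.tendsto_add_atTop_iff_nat 1).2 hh)
    rwa [hfix h h₂] at hh
  rw [Metric.tendsto_atTop]
  intro ε hε
  obtain ⟨x, hx⟩ := hdense.exists_dist_lt f (half_pos hε)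
  obtain ⟨N, hN⟩ := Metric.tendsto_atTop.1 (hrange x) (ε / 2) (half_pos hε)
  refine ⟨N, fun n hn => ?_⟩
  have h₁ := hN n hn
  have h₂ := norm_pow_apply_le_of_norm_le_one hT n (f - A x)
  rw [dist_eq_norm] at hx
  rw [dist_zero_right] at h₁ ⊢
  calc ‖(T ^ n) f‖ = ‖(T ^ n) (f - A x) + (T ^ n) (A x)‖ := by rw [map_sub, sub_add_cancel]
    _ ≤ ‖(T ^ n) (f - A x)‖ + ‖(T ^ n) (A x)‖ := norm_add_le _ _
    _ < ε := by linarith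

/-- The Douglas lemma for positive operators with `H ^ 2 ≤ A ^ 2`, in rank-one perturbation form. -/
lemma exists_contraction_mul_eq {A H : E →L[ℂ] E} (hA : A.IsPositive)
    (hinj : ∀ x, A x = 0 → x = 0) (hH : H.IsPositive) {w : E}
    (hH2 : ∀ f, (H ^ 2) f = (A ^ 2) f - ⟪w, f⟫ • w) :
    ∃ T : E →L[ℂ] E, ‖T‖ ≤ 1 ∧ T * A = H := by
  have hdense : DenseRange A := denseRange_of_isSelfAdjoint_of_injective hA.isSelfAdjoint hinj
  have hle : ∀ x, ‖H x‖ ≤ ‖A x‖ := by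
    intro x
    have hsq : ∀ {B : E →L[ℂ] E}, B.IsPositive → ‖B x‖ ^ 2 = RCLike.re ⟪(B ^ 2) x, x⟫ := by
      intro B hB
      rw [pow_two B, mul_apply_eq_comp, hB.inner_left_eq_inner_right,
        inner_self_eq_norm_sq]
    refine (pow_le_pow_iff_left₀ (norm_nonneg _) (norm_nonneg _) two_ne_zero).1 ?_
    rw [hsq hH, hsq hA, hH2, inner_sub_left, map_sub, inner_smul_left, inner_conj_symm]
    have : 0 ≤ RCLike.re (⟪x, w⟫ * ⟪w, x⟫) := by
      rw [← inner_conj_symm x w, RCLike.conj_mul]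
      norm_cast
      positivity
    linarith
  have hnorm : ∀ x, ‖(H : E →ₗ[ℂ] E) x‖ ≤ 1 * ‖(A : E →ₗ[ℂ] E) x‖ := by simpa using hle
  refine ⟨(H : E →ₗ[ℂ] E).extendOfNorm (A : E →ₗ[ℂ] E),
    LinearMap.opNorm_extendOfNorm_le hdense zero_le_one hnorm, ?_⟩
  ext x
  exact LinearMap.extendOfNorm_eq hdense ⟨1, hnorm⟩ x

end Hilbert

/-- An integrable function on a bounded interval all of whose moments vanish is zero almost
everywhere. -/
lemma ae_eq_zero_of_integral_pow_smul_eq_zero {μ : Measure ℝ} {a b : ℝ}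
    (hsupp : ∀ᵐ x ∂μ, x ∈ Set.Icc a b) {g : ℝ → ℂ} (hg : Integrable g μ)
    (hmom : ∀ n : ℕ, ∫ x, x ^ n • g x ∂μ = 0) : ∀ᵐ x ∂μ, g x = 0 := by
  have hint : ∀ φ : ℝ → ℝ, Continuous φ → Integrable (fun x => φ x • g x) μ := by
    intro φ hφ
    obtain ⟨K, hK⟩ := isCompact_Icc.exists_bound_of_continuousOn (hφ.continuousOn (s := Set.Icc a b))
    exact hg.bdd_smul K hφ.aestronglyMeasurable (hsupp.mono hK)
  have hpoly : ∀ p : Polynomial ℝ, ∫ x, p.eval x • g x ∂μ = 0 := by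
    intro p
    simp only [Polynomial.eval_eq_sum_range, Finset.sum_smul]
    rw [integral_finsetSum _ fun i _ => hint (fun x => p.coeff i * x ^ i) (by fun_prop)]
    refine Finset.sum_eq_zero fun i _ => ?_
    simp only [mul_smul, integral_smul, hmom, smul_zero]
  refine ae_eq_zero_of_integral_contDiff_smul_eq_zero hg.locallyIntegrable fun φ hφ _ => ?_
  refine norm_le_zero_iff.1 (le_of_forall_pos_le_add fun ε hε => ?_)
  rw [zero_add]
  have hG : 0 ≤ ∫ x, ‖g x‖ ∂μ := integral_nonneg fun x => norm_nonneg _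
  obtain ⟨p, hp⟩ := exists_polynomial_near_of_continuousOn a b φ hφ.continuous.continuousOn
    (ε / (∫ x, ‖g x‖ ∂μ + 1)) (by positivity)
  calc ‖∫ x, φ x • g x ∂μ‖ = ‖∫ x, (φ x - p.eval x) • g x ∂μ‖ := by
        simp only [sub_smul]
        rw [integral_sub (hint φ hφ.continuous) (hint (fun x => p.eval x) p.continuous), hpoly,
          sub_zero]
    _ ≤ ∫ x, ε / (∫ x, ‖g x‖ ∂μ + 1) * ‖g x‖ ∂μ := by
        refine norm_integral_le_of_norm_le (hg.norm.const_mul _) (hsupp.mono fun x hx => ?_)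
        rw [norm_smul, Real.norm_eq_abs, abs_sub_comm]
        gcongr
        exact (hp x hx).le
    _ ≤ ε := by
        rw [integral_const_mul, div_mul_eq_mul_div, div_le_iff₀ (by positivity)]
        nlinarith

section Multiplication

variable {ρ : Measure ℝ} {A : Lp ℂ 2 ρ →L[ℂ] Lp ℂ 2 ρ}

lemma isPositive_of_ae_eq_mul {m : ℝ → ℝ} (hm : ∀ x, 0 ≤ m x)
    (hA : ∀ f : Lp ℂ 2 ρ, ∀ᵐ x ∂ρ, (A f) x = (m x : ℂ) * f x) : A.IsPositive := by
  refine ContinuousLinearMap.isPositive_def.2 ⟨fun f g => ?_, fun f => ?_⟩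
  · simp only [L2.inner_def, ContinuousLinearMap.coe_coe]
    refine integral_congr_ae ?_
    filter_upwards [hA f, hA g] with x hf hg
    simp only [hf, hg, RCLike.inner_apply, map_mul, Complex.conj_ofReal]
    ring
  · rw [ContinuousLinearMap.reApplyInnerSelf_apply, L2.inner_def,
      ← integral_re (L2.integrable_inner _ _)]
    refine integral_nonneg_of_ae ?_
    filter_upwards [hA f] with x hf
    rw [hf, ← smul_eq_mul, inner_smul_left, Complex.conj_ofReal, Pi.zero_apply]
    refine le_of_le_of_eq ?_ (Complex.re_ofReal_mul _ _).symm
    exact mul_nonneg (hm x) (inner_self_nonneg (𝕜 := ℂ) (x := f x))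

lemma eq_zero_of_ae_eq_mul {m : ℝ → ℝ} (hm : ∀ᵐ x ∂ρ, m x ≠ 0)
    (hA : ∀ f : Lp ℂ 2 ρ, ∀ᵐ x ∂ρ, (A f) x = (m x : ℂ) * f x) (f : Lp ℂ 2 ρ) (hf : A f = 0) :
    f = 0 := by
  refine (Lp.eq_zero_iff_ae_eq_zero).2 ?_
  have h := hA f
  rw [hf] at h
  filter_upwards [h, hm, Lp.coeFn_zero ℂ 2 ρ] with x hx hmx h0
  rw [h0, Pi.zero_apply, eq_comm, mul_eq_zero] at hx
  exact hx.resolve_left (Complex.ofReal_ne_zero.2 hmx)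

lemma pow_apply_ae_eq_mul {m : ℝ → ℝ}
    (hA : ∀ f : Lp ℂ 2 ρ, ∀ᵐ x ∂ρ, (A f) x = (m x : ℂ) * f x) (n : ℕ) (f : Lp ℂ 2 ρ) :
    ∀ᵐ x ∂ρ, ((A ^ n) f) x = ((m x ^ n : ℝ) : ℂ) * f x := by
  induction n with
  | zero => simp
  | succ n ih =>
    rw [pow_succ', mul_apply_eq_comp]
    filter_upwards [hA ((A ^ n) f), ih] with x h₁ h₂
    rw [h₁, h₂]
    push_cast
    ring

end Multiplication

theorem statement18 (ρ : Measure ℝ) (hfin : IsFiniteMeasure ρ)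
    (hsupp : ∃ C : ℝ, 0 ≤ C ∧ ρ (Set.Icc (0 : ℝ) C)ᶜ = 0)
    (h0 : ρ {0} = 0) (h1 : ρ Set.univ ≤ 1)
    (H₀ : Lp ℂ 2 ρ →L[ℂ] Lp ℂ 2 ρ)
    (hH₀ : ∀ f : Lp ℂ 2 ρ, ∀ᵐ x ∂ρ, (H₀ f) x = (Real.sqrt x : ℂ) * f x)
    (one : Lp ℂ 2 ρ) (hone : ∀ᵐ x ∂ρ, one x = 1)
    (H : Lp ℂ 2 ρ →L[ℂ] Lp ℂ 2 ρ) (hHpos : H.IsPositive)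
    (hH2 : ∀ f : Lp ℂ 2 ρ,
      (H ^ 2) f = (H₀ ^ 2) f - ⟪H₀ one, f⟫ • (H₀ one)) :
    (∃ Sig : Lp ℂ 2 ρ →L[ℂ] Lp ℂ 2 ρ, ‖Sig‖ ≤ 1 ∧ Sig.comp H₀ = H) ∧
    ∀ Sig : Lp ℂ 2 ρ →L[ℂ] Lp ℂ 2 ρ, ‖Sig‖ ≤ 1 → Sig.comp H₀ = H →
      ∀ f : Lp ℂ 2 ρ,
        Filter.Tendsto (fun n : ℕ => ‖(Sig ^ n) f‖) Filter.atTop (nhds 0) := by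
  obtain ⟨C, -, hC⟩ := hsupp
  have hIcc : ∀ᵐ x ∂ρ, x ∈ Set.Icc 0 C := hC
  have hne : ∀ᵐ x ∂ρ, x ≠ 0 := by simpa [ae_iff] using h0
  have hpos : H₀.IsPositive := isPositive_of_ae_eq_mul Real.sqrt_nonneg hH₀
  have hinj : ∀ f, H₀ f = 0 → f = 0 := by
    refine eq_zero_of_ae_eq_mul ?_ hH₀
    filter_upwards [hIcc, hne] with x hx hx0
    exact Real.sqrt_ne_zero'.2 (lt_of_le_of_ne hx.1 hx0.symm)
  have hcyc : ∀ g, (∀ n : ℕ, ⟪one, (H₀ ^ (2 * n)) g⟫ = 0) → g = 0 := by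
    intro g hg
    refine (Lp.eq_zero_iff_ae_eq_zero).2 (ae_eq_zero_of_integral_pow_smul_eq_zero hIcc
      ((Lp.memLp g).integrable one_le_two) fun n => ?_)
    rw [← hg n, L2.inner_def]
    refine integral_congr_ae ?_
    filter_upwards [hone, hIcc, pow_apply_ae_eq_mul hH₀ (2 * n) g] with x h₁ hx h₂
    rw [h₁, h₂, pow_mul, Real.sq_sqrt hx.1]
    simp
  refine ⟨exists_contraction_mul_eq hpos hinj hHpos hH2, fun Sig hSig hcomp f => ?_⟩
  simpa using
    (tendsto_pow_apply_of_rank_one_perturbation hpos hinj hHpos hH2 hcyc hSig hcomp f).norm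
end

section
/- Let α be the real sequence α_n = 1/(n+1), n ≥ 0 (so Γ_α is the Hilbert matrix, which is bounded with Γ_α ≥ 0 and Γ_{S*α} ≥ 0). Then for every z ∈ ℂ∖[0,π²]: ⟨(Γ_α² − zI)^{-1} e₀, e₀⟩ = ∫₀^{π²} (λ − z)^{-1} · (π²√λ)^{-1} · log(π/√λ + √(π²/λ − 1)) dλ. Equivalently, for every z ∈ ℂ∖[0,∞): −z⟨(Γ_α² − zI)^{-1} e₀, e₀⟩ = log(ζ + √(ζ² + 1))/ζ, where ζ = π/√(−z) with the principal branch of the square root (positive on the positive reals) and principal branches throughout. -/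
open scoped ComplexInnerProductSpace ComplexOrder ENNReal NNReal
open MeasureTheory Filter

noncomputable section

abbrev ℓ2 : Type := lp (fun _ : ℕ => ℂ) 2

def e (n : ℕ) : ℓ2 := lp.single 2 n 1

def IsHankelOp (α : ℕ → ℝ) (Γ : ℓ2 →L[ℂ] ℓ2) : Prop :=
  ∀ n m : ℕ, ⟪Γ (e n), e m⟫ = (α (n + m) : ℂ)

def PosOp (Γ : ℓ2 →L[ℂ] ℓ2) : Prop := ∀ x : ℓ2, 0 ≤ ⟪Γ x, x⟫

def MemL1infPP (α : ℕ → ℝ) (Γ ΓS : ℓ2 →L[ℂ] ℓ2) : Prop :=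
  (∃ C : ℝ, ∀ n : ℕ, (n + 1 : ℝ) * |α n| ≤ C) ∧
  IsHankelOp α Γ ∧ IsHankelOp (fun n => α (n + 1)) ΓS ∧ PosOp Γ ∧ PosOp ΓS

theorem lintegral_Ioi_scale {c : ℝ} (hc : 0 < c) (f : ℝ → ℝ≥0∞) :
    ∫⁻ t in Set.Ioi (0 : ℝ), f t = ∫⁻ t in Set.Ioi (0 : ℝ), ENNReal.ofReal c * f (c * t) := by
  have h := lintegral_image_eq_lintegral_abs_deriv_mul (s := Set.Ioi (0 : ℝ)) (f := fun t => c * t)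
    (f' := fun _ => c) measurableSet_Ioi
    (fun x _ => by simpa using ((hasDerivAt_id x).const_mul c).hasDerivWithinAt)
    (fun x _ y _ h => mul_left_cancel₀ hc.ne' h) f
  rw [abs_of_pos hc, Set.image_mul_left_Ioi hc, mul_zero] at h
  exact h

theorem image_div_one_sub_Ioo :
    (fun x : ℝ => x / (1 - x)) '' Set.Ioo 0 1 = Set.Ioi 0 := by
  ext t
  simp only [Set.mem_image, Set.mem_Ioo, Set.mem_Ioi]
  constructor
  · rintro ⟨x, ⟨h0, h1⟩, rfl⟩
    exact div_pos h0 (by linarith)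
  · intro ht
    refine ⟨t / (1 + t), ⟨by positivity, by rw [div_lt_one (by positivity)]; linarith⟩, ?_⟩
    field_simp
    ring

/-- The Euler integral in the form of the Mellin transform of `1 / (1 + t)`. -/
theorem lintegral_rpow_div_one_add {s : ℝ} (h0 : 0 < s) (h1 : s < 1) :
    ∫⁻ t in Set.Ioi (0 : ℝ), ENNReal.ofReal (t ^ (s - 1) / (1 + t)) =
      ENNReal.ofReal (Real.pi / Real.sin (Real.pi * s)) := by
  have hb := ProbabilityTheory.lintegral_betaPDF_eq_one h0 (sub_pos.2 h1)
  rw [ProbabilityTheory.lintegral_betaPDF] at hb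
  have hbeta : ProbabilityTheory.beta s (1 - s) = Real.pi / Real.sin (Real.pi * s) := by
    rw [ProbabilityTheory.beta, Real.Gamma_mul_Gamma_one_sub]; simp
  have hpos := ProbabilityTheory.beta_pos h0 (sub_pos.2 h1)
  rw [hbeta] at hb hpos
  set B := Real.pi / Real.sin (Real.pi * s)
  have h := lintegral_image_eq_lintegral_abs_deriv_mul (s := Set.Ioo (0 : ℝ) 1)
    (f := fun x => x / (1 - x)) (f' := fun x => 1 / (1 - x) ^ 2) measurableSet_Ioo
    (fun x hx => by
      have hx1 : (1 : ℝ) - x ≠ 0 := by have := hx.2; intro h; linarith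
      have := ((hasDerivAt_id x).div ((hasDerivAt_id x).const_sub 1) hx1).hasDerivWithinAt
        (s := Set.Ioo (0 : ℝ) 1)
      exact this.congr_deriv (by simp))
    (fun x hx y hy h => by
      have hx1 : (1 : ℝ) - x ≠ 0 := by have := hx.2; intro h; linarith
      have hy1 : (1 : ℝ) - y ≠ 0 := by have := hy.2; intro h; linarith
      field_simp at h
      linarith) (fun t => ENNReal.ofReal (t ^ (s - 1) / (1 + t)))
  rw [image_div_one_sub_Ioo] at h
  rw [h]
  have : ∫⁻ x in Set.Ioo (0 : ℝ) 1, ENNReal.ofReal |1 / (1 - x) ^ 2| *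
      ENNReal.ofReal ((x / (1 - x)) ^ (s - 1) / (1 + x / (1 - x))) =
      ∫⁻ x in Set.Ioo (0 : ℝ) 1, ENNReal.ofReal B *
        ENNReal.ofReal (1 / B * x ^ (s - 1) * (1 - x) ^ (1 - s - 1)) := by
    refine setLIntegral_congr_fun measurableSet_Ioo fun x hx => ?_
    have hx1 : (0 : ℝ) < 1 - x := by linarith [hx.2]
    have hx0 := hx.1
    rw [← ENNReal.ofReal_mul (abs_nonneg _), ← ENNReal.ofReal_mul hpos.le]
    congr 1
    rw [abs_of_pos (by positivity), Real.div_rpow hx0.le hx1.le, Real.rpow_sub_one hx1.ne',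
      Real.rpow_sub_one hx1.ne', Real.rpow_sub hx1, Real.rpow_one]
    have : (1 - x) ^ s ≠ 0 := (Real.rpow_pos_of_pos hx1 s).ne'
    field_simp
    ring
  rw [this, lintegral_const_mul _ (by fun_prop), hb, mul_one]

theorem lintegral_rpow_div_add {s : ℝ} (h0 : 0 < s) (h1 : s < 1) {b : ℝ} (hb : 0 < b) :
    ∫⁻ t in Set.Ioi (0 : ℝ), ENNReal.ofReal (t ^ (s - 1) / (b + t)) =
      ENNReal.ofReal (Real.pi / Real.sin (Real.pi * s)) * ENNReal.ofReal (b ^ (s - 1)) := by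
  rw [lintegral_Ioi_scale hb, ← lintegral_rpow_div_one_add h0 h1,
    ← lintegral_mul_const _ (by fun_prop)]
  refine setLIntegral_congr_fun measurableSet_Ioi fun t (ht : 0 < t) => ?_
  rw [← ENNReal.ofReal_mul hb.le, ← ENNReal.ofReal_mul (by positivity)]
  congr 1
  rw [Real.mul_rpow hb.le ht.le]
  field_simp

/-- Moments of the substitution `x = w / (1 + w)`. -/
theorem lintegral_div_one_add_pow (k : ℕ) :
    ∫⁻ w in Set.Ioi (0 : ℝ), ENNReal.ofReal ((w / (1 + w)) ^ k / (1 + w) ^ 2) =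
      ENNReal.ofReal (1 / (k + 1)) := by
  have hd : ∀ w ∈ Set.Ici (0 : ℝ), HasDerivAt (fun w : ℝ => (w / (1 + w)) ^ (k + 1) / (k + 1))
      ((w / (1 + w)) ^ k / (1 + w) ^ 2) w := by
    intro w (hw : 0 ≤ w)
    have hw1 : 1 + w ≠ 0 := by positivity
    refine ((((hasDerivAt_id w).div ((hasDerivAt_id w).const_add 1) hw1).pow (k + 1)).div_const
      ((k : ℝ) + 1)).congr_deriv ?_
    have : (k : ℝ) + 1 ≠ 0 := by positivity
    simp
    field_simp
  have hn : ∀ w ∈ Set.Ioi (0 : ℝ), 0 ≤ (w / (1 + w)) ^ k / (1 + w) ^ 2 := by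
    intro w (hw : 0 < w); positivity
  have ht : Tendsto (fun w : ℝ => (w / (1 + w)) ^ (k + 1) / (k + 1)) atTop
      (nhds (1 / ((k : ℝ) + 1))) := by
    have h1 : Tendsto (fun w : ℝ => w / (1 + w)) atTop (nhds 1) := by
      have : Tendsto (fun w : ℝ => 1 - (1 + w)⁻¹) atTop (nhds (1 - 0)) :=
        (tendsto_inv_atTop_zero.comp (tendsto_atTop_add_const_left _ 1 tendsto_id)).const_sub 1
      rw [sub_zero] at this
      refine this.congr' ?_
      filter_upwards [eventually_gt_atTop 0] with w hw
      field_simp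
      ring
    simpa using (h1.pow (k + 1)).div_const ((k : ℝ) + 1)
  rw [← ofReal_integral_eq_lintegral_ofReal (integrableOn_Ioi_deriv_of_nonneg' hd hn ht)
    ((ae_restrict_iff' measurableSet_Ioi).2 (ae_of_all _ hn)),
    integral_Ioi_of_hasDerivAt_of_nonneg' hd hn ht]
  simp

/-- The common value of both sides of the eigenvector identity, as an integrand. -/
def mehlerKernel (s : ℝ) (n : ℕ) (w t : ℝ) : ℝ :=
  (w / (1 + w)) ^ n * t ^ (s - 1) * (1 + w * t / (1 + t)) ^ (s - 1) / ((1 + t) * (1 + w))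

theorem lintegral_pow_mul_eq_mehlerKernel (s : ℝ) (n : ℕ) :
    ∫⁻ u in Set.Ioi (0 : ℝ), ∫⁻ t in Set.Ioi (0 : ℝ),
      ENNReal.ofReal ((1 - t / ((1 + t) * (1 + u))) ^ n *
        (t ^ (s - 1) / (1 + t) * (u ^ (s - 1) / (1 + u)))) =
    ∫⁻ w in Set.Ioi (0 : ℝ), ∫⁻ t in Set.Ioi (0 : ℝ), ENNReal.ofReal (mehlerKernel s n w t) := by
  have h1 : ∀ u ∈ Set.Ioi (0 : ℝ), ∫⁻ t in Set.Ioi (0 : ℝ),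
      ENNReal.ofReal ((1 - t / ((1 + t) * (1 + u))) ^ n *
        (t ^ (s - 1) / (1 + t) * (u ^ (s - 1) / (1 + u)))) =
      ∫⁻ t in Set.Ioi (0 : ℝ), ENNReal.ofReal ((1 + u) / u) *
      ENNReal.ofReal ((1 - ((1 + u) / u * t) / ((1 + ((1 + u) / u * t)) * (1 + u))) ^ n *
        (((1 + u) / u * t) ^ (s - 1) / (1 + ((1 + u) / u * t)) * (u ^ (s - 1) / (1 + u)))) := by
    intro u (hu : 0 < u)
    exact lintegral_Ioi_scale (by positivity) _
  rw [setLIntegral_congr_fun measurableSet_Ioi h1,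
    lintegral_lintegral_swap (Measurable.aemeasurable (by fun_prop))]
  have h2 : ∀ t ∈ Set.Ioi (0 : ℝ), ∫⁻ u in Set.Ioi (0 : ℝ), ENNReal.ofReal ((1 + u) / u) *
      ENNReal.ofReal ((1 - ((1 + u) / u * t) / ((1 + ((1 + u) / u * t)) * (1 + u))) ^ n *
        (((1 + u) / u * t) ^ (s - 1) / (1 + ((1 + u) / u * t)) * (u ^ (s - 1) / (1 + u)))) =
      ∫⁻ w in Set.Ioi (0 : ℝ), ENNReal.ofReal (mehlerKernel s n w t) := by
    intro t (ht : 0 < t)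
    rw [lintegral_Ioi_scale (c := t / (1 + t)) (by positivity)]
    refine setLIntegral_congr_fun measurableSet_Ioi fun w (hw : 0 < w) => ?_
    obtain ⟨u, hu⟩ : ∃ u, u = t / (1 + t) * w := ⟨_, rfl⟩
    have hu0 : 0 < u := by rw [hu]; positivity
    rw [← hu, ← ENNReal.ofReal_mul (by positivity), ← ENNReal.ofReal_mul (by positivity)]
    congr 1
    have hp : 1 - ((1 + u) / u * t) / ((1 + ((1 + u) / u * t)) * (1 + u)) = w / (1 + w) := by
      rw [hu]; field_simp; ring
    have hr : ((1 + u) / u * t) ^ (s - 1) * u ^ (s - 1) =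
        t ^ (s - 1) * (1 + w * t / (1 + t)) ^ (s - 1) := by
      rw [← Real.mul_rpow (by positivity) (by positivity),
        ← Real.mul_rpow (by positivity) (by positivity)]
      congr 1
      rw [hu]; field_simp
    have hq : t / (1 + t) * ((1 + u) / u) / ((1 + ((1 + u) / u * t)) * (1 + u)) =
        1 / ((1 + t) * (1 + w)) := by
      rw [hu]; field_simp; ring
    rw [hp, mehlerKernel]
    calc _ = (w / (1 + w)) ^ n * (((1 + u) / u * t) ^ (s - 1) * u ^ (s - 1)) *
          (t / (1 + t) * ((1 + u) / u) / ((1 + ((1 + u) / u * t)) * (1 + u))) := by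
          field_simp
      _ = _ := by rw [hr, hq]; field_simp
  rw [setLIntegral_congr_fun measurableSet_Ioi h2,
    lintegral_lintegral_swap (Measurable.aemeasurable (by unfold mehlerKernel; fun_prop))]

theorem lintegral_resolvent_eq_mehlerKernel {s : ℝ} (h0 : 0 < s) (h1 : s < 1) (n : ℕ) :
    ∫⁻ w in Set.Ioi (0 : ℝ), ∫⁻ t in Set.Ioi (0 : ℝ), ∫⁻ u in Set.Ioi (0 : ℝ),
      ENNReal.ofReal ((w / (1 + w)) ^ n / (1 + w) ^ 2 *
        (1 - (1 - t / ((1 + t) * (1 + u))) * (w / (1 + w)))⁻¹ *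
        (t ^ (s - 1) / (1 + t) * (u ^ (s - 1) / (1 + u)))) =
    ENNReal.ofReal (Real.pi / Real.sin (Real.pi * s)) *
    ∫⁻ w in Set.Ioi (0 : ℝ), ∫⁻ t in Set.Ioi (0 : ℝ), ENNReal.ofReal (mehlerKernel s n w t) := by
  rw [← lintegral_const_mul _ (Measurable.lintegral_prod_right
    (f := fun w t => ENNReal.ofReal (mehlerKernel s n w t)) (by unfold mehlerKernel; fun_prop))]
  refine setLIntegral_congr_fun measurableSet_Ioi fun w (hw : 0 < w) => ?_
  rw [← lintegral_const_mul _ (by unfold mehlerKernel; fun_prop)]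
  refine setLIntegral_congr_fun measurableSet_Ioi fun t (ht : 0 < t) => ?_
  have h : ∀ u ∈ Set.Ioi (0 : ℝ), ENNReal.ofReal ((w / (1 + w)) ^ n / (1 + w) ^ 2 *
        (1 - (1 - t / ((1 + t) * (1 + u))) * (w / (1 + w)))⁻¹ *
        (t ^ (s - 1) / (1 + t) * (u ^ (s - 1) / (1 + u)))) =
      ENNReal.ofReal ((w / (1 + w)) ^ n * t ^ (s - 1) / ((1 + t) * (1 + w))) *
      ENNReal.ofReal (u ^ (s - 1) / ((1 + w * t / (1 + t)) + u)) := by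
    intro u (hu : 0 < u)
    rw [← ENNReal.ofReal_mul (by positivity)]
    congr 1
    have : (1 - (1 - t / ((1 + t) * (1 + u))) * (w / (1 + w))) =
        (1 + u + w * t / (1 + t)) / ((1 + w) * (1 + u)) := by
      field_simp; ring
    rw [this]
    field_simp
    ring
  rw [setLIntegral_congr_fun measurableSet_Ioi h, lintegral_const_mul _ (by fun_prop),
    lintegral_rpow_div_add h0 h1 (by positivity), mul_left_comm,
    ← ENNReal.ofReal_mul (by positivity), mehlerKernel]
  congr 2
  field_simp

/-- From an eigenvector of the Hilbert matrix tending to zero, one gets a solution of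
`(Γ + c) F = v 0 • e 0`. -/
theorem hasSum_hilbert_sndDiff {v : ℕ → ℝ} {c : ℝ} (hv : Tendsto v atTop (nhds 0))
    (hanti : Antitone v) (hsum : ∀ n : ℕ, HasSum (fun m : ℕ => v m / (n + m + 1)) (c * v n))
    (n : ℕ) :
    HasSum (fun m : ℕ => ((m + 1) * (v m - v (m + 1)) - m * (v (m - 1) - v m)) / (n + m + 1))
      ((if n = 0 then v 0 else 0) -
        c * ((n + 1) * (v n - v (n + 1)) - n * (v (n - 1) - v n))) := by
  have hD : HasSum (fun m => v m - v (m + 1)) (v 0) := by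
    rw [hasSum_iff_tendsto_nat_of_nonneg (fun m => sub_nonneg.2 (hanti (Nat.le_succ m)))]
    simp only [Finset.sum_range_sub']
    simpa using hv.const_sub (v 0)
  have hshift : ∀ n : ℕ, HasSum (fun m : ℕ => v (m + 1) / (n + 1 + m + 1))
      (c * v n - v 0 / (n + 1)) := by
    intro n
    have := (hasSum_nat_add_iff' 1).2 (hsum n)
    simp only [Finset.range_one, Finset.sum_singleton, Nat.cast_zero, add_zero] at this
    convert! this using 3 with m
    push_cast; ring
  have hK : ∀ n : ℕ, HasSum (fun m : ℕ => (m + 1) * (v m - v (m + 1)) / (n + m + 1))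
      (if n = 0 then v 0 else c * (n * (v (n - 1) - v n))) := by
    intro n
    rcases n with _ | n
    · simp only [if_true]
      convert! hD using 2 with m
      have : (m : ℝ) + 1 ≠ 0 := by positivity
      push_cast
      field_simp
      ring
    · simp only [Nat.add_eq_zero_iff, one_ne_zero, and_false, if_false, Nat.add_sub_cancel]
      have h := hD.sub (((hsum (n + 1)).sub (by exact_mod_cast hshift n)).mul_left ((n : ℝ) + 1))
      convert! h using 1
      · ext m
        have : (n : ℝ) + 1 + m + 1 ≠ 0 := by positivity
        push_cast
        field_simp
        ring
      · have : (n : ℝ) + 1 ≠ 0 := by positivity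
        push_cast
        field_simp
        ring
  have hL : HasSum (fun m : ℕ => (m : ℝ) * (v (m - 1) - v m) / (n + m + 1))
      (c * ((n + 1) * (v n - v (n + 1)))) := by
    rw [← hasSum_nat_add_iff' 1]
    have := hK (n + 1)
    simp only [Nat.add_eq_zero_iff, one_ne_zero, and_false, if_false, Nat.add_sub_cancel] at this
    convert! this using 1
    · ext m; rw [Nat.add_sub_cancel]; push_cast; ring
    · simp
  convert! (hK n).sub hL using 1
  · ext m; ring
  · split_ifs with h
    · simp [h]
    · ring

theorem mul_one_sub_mul_pow_le {p : ℝ} (h0 : 0 ≤ p) (h1 : p ≤ 1) (m : ℕ) :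
    (m + 1) * ((1 - p) * p ^ m) ≤ 1 := by
  have h := mul_neg_geom_sum p (m + 1)
  have hs : ((m : ℝ) + 1) * p ^ m ≤ ∑ i ∈ Finset.range (m + 1), p ^ i := by
    have := Finset.card_nsmul_le_sum (Finset.range (m + 1)) (fun i => p ^ i) (p ^ m)
      (fun i hi => pow_le_pow_of_le_one h0 h1 (Nat.lt_succ_iff.1 (Finset.mem_range.1 hi)))
    simpa using this
  have hp : 0 ≤ p ^ (m + 1) := by positivity
  nlinarith [mul_le_mul_of_nonneg_left hs (sub_nonneg.2 h1)]

theorem abs_sndDiff_pow_le {p : ℝ} (h0 : 0 ≤ p) (h1 : p ≤ 1) (m : ℕ) :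
    |(m + 1) * (p ^ m - p ^ (m + 1)) - m * (p ^ (m - 1) - p ^ m)| ≤ 8 / (m + 1) := by
  have hm1 : (0 : ℝ) < m + 1 := by positivity
  rcases m with _ | m
  · simp; rw [abs_le]; constructor <;> linarith
  rw [le_div_iff₀ hm1, Nat.add_sub_cancel]
  have hA := mul_one_sub_mul_pow_le h0 h1 (m + 1)
  have hA0 : 0 ≤ (m + 1 + 1) * ((1 - p) * p ^ (m + 1)) :=
    mul_nonneg (by positivity) (mul_nonneg (sub_nonneg.2 h1) (by positivity))
  obtain ⟨k, hk⟩ : ∃ k, m = 2 * k ∨ m = 2 * k + 1 := ⟨m / 2, by omega⟩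
  have hB := mul_one_sub_mul_pow_le h0 h1 k
  have hB0 : 0 ≤ ((k : ℝ) + 1) * ((1 - p) * p ^ k) :=
    mul_nonneg (by positivity) (mul_nonneg (sub_nonneg.2 h1) (by positivity))
  have hB2 : ((k : ℝ) + 1) ^ 2 * ((1 - p) ^ 2 * p ^ (2 * k)) ≤ 1 := by
    calc _ = (((k : ℝ) + 1) * ((1 - p) * p ^ k)) ^ 2 := by ring
      _ ≤ 1 := pow_le_one₀ hB0 hB
  have hpm : p ^ m ≤ p ^ (2 * k) := pow_le_pow_of_le_one h0 h1 (by omega)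
  have hC : ((m : ℝ) + 1) * (m + 2) * ((1 - p) ^ 2 * p ^ m) ≤ 6 := by
    have hmk : ((m : ℝ) + 1) * (m + 2) ≤ 6 * (k + 1) ^ 2 := by
      rcases hk with hk | hk <;> · rw [hk]; push_cast; nlinarith [(Nat.cast_nonneg k : (0 : ℝ) ≤ k)]
    calc _ ≤ (6 * ((k : ℝ) + 1) ^ 2) * ((1 - p) ^ 2 * p ^ (2 * k)) := by gcongr
      _ ≤ 6 := by linarith
  have hC0 : 0 ≤ ((m : ℝ) + 1) * (m + 2) * ((1 - p) ^ 2 * p ^ m) := by positivity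
  rw [show (((m + 1 : ℕ) : ℝ) + 1) * (p ^ (m + 1) - p ^ (m + 1 + 1)) -
      ((m + 1 : ℕ) : ℝ) * (p ^ m - p ^ (m + 1)) =
      (1 - p) * p ^ (m + 1) - (m + 1) * ((1 - p) ^ 2 * p ^ m) by push_cast; ring]
  rw [← abs_of_pos hm1, ← abs_mul, abs_le]
  push_cast at *
  constructor <;> nlinarith

/-- The measure `t ^ (s - 1) / (1 + t) dt` on the positive half-line. -/
def betaPrimeMeasure (s : ℝ) : Measure ℝ :=
  (volume.restrict (Set.Ioi 0)).withDensity fun t => ENNReal.ofReal (t ^ (s - 1) / (1 + t))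

theorem betaPrimeMeasure_univ {s : ℝ} (h0 : 0 < s) (h1 : s < 1) :
    betaPrimeMeasure s Set.univ = ENNReal.ofReal (Real.pi / Real.sin (Real.pi * s)) := by
  rw [betaPrimeMeasure, withDensity_apply _ MeasurableSet.univ, Measure.restrict_univ,
    lintegral_rpow_div_one_add h0 h1]

theorem isFiniteMeasure_betaPrimeMeasure {s : ℝ} (h0 : 0 < s) (h1 : s < 1) :
    IsFiniteMeasure (betaPrimeMeasure s) :=
  ⟨by rw [betaPrimeMeasure_univ h0 h1]; exact ENNReal.ofReal_lt_top⟩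

instance sFinite_betaPrimeMeasure (s : ℝ) : SFinite (betaPrimeMeasure s) := by
  unfold betaPrimeMeasure; infer_instance

theorem ae_pos_betaPrimeMeasure (s : ℝ) : ∀ᵐ t ∂betaPrimeMeasure s, 0 < t :=
  (withDensity_absolutelyContinuous _ _).ae_le (ae_restrict_mem measurableSet_Ioi)

theorem ae_pos_betaPrimeMeasure_prod (s : ℝ) :
    ∀ᵐ z ∂(betaPrimeMeasure s).prod (betaPrimeMeasure s), 0 < z.1 ∧ 0 < z.2 := by
  have h := ae_pos_betaPrimeMeasure s
  exact (Measure.quasiMeasurePreserving_fst.ae h).and (Measure.quasiMeasurePreserving_snd.ae h)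

theorem lintegral_betaPrimeMeasure (s : ℝ) {f : ℝ → ℝ≥0∞} (hf : Measurable f) :
    ∫⁻ t, f t ∂betaPrimeMeasure s =
      ∫⁻ t in Set.Ioi (0 : ℝ), f t * ENNReal.ofReal (t ^ (s - 1) / (1 + t)) := by
  rw [betaPrimeMeasure, lintegral_withDensity_eq_lintegral_mul _ (by fun_prop) hf]
  simp only [Pi.mul_apply, mul_comm]

theorem lintegral_betaPrimeMeasure_prod (s : ℝ) {f : ℝ × ℝ → ℝ} (hf : Measurable f)
    (hpos : ∀ u t, 0 < u → 0 < t → 0 ≤ f (u, t)) :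
    ∫⁻ z, ENNReal.ofReal (f z) ∂(betaPrimeMeasure s).prod (betaPrimeMeasure s) =
      ∫⁻ u in Set.Ioi (0 : ℝ), ∫⁻ t in Set.Ioi (0 : ℝ),
        ENNReal.ofReal (f (u, t) * (t ^ (s - 1) / (1 + t) * (u ^ (s - 1) / (1 + u)))) := by
  rw [lintegral_prod _ (by fun_prop), lintegral_betaPrimeMeasure _
    (Measurable.lintegral_prod_right' (f := fun z => ENNReal.ofReal (f z)) (by fun_prop))]
  refine setLIntegral_congr_fun measurableSet_Ioi fun u (hu : 0 < u) => ?_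
  rw [lintegral_betaPrimeMeasure _ (by fun_prop), ← lintegral_mul_const _ (by fun_prop)]
  refine setLIntegral_congr_fun measurableSet_Ioi fun t (ht : 0 < t) => ?_
  have := hpos u t hu ht
  rw [← ENNReal.ofReal_mul (by positivity), ← ENNReal.ofReal_mul (by positivity)]
  congr 1
  ring

/-- In the coordinates of `betaPrimeMeasure`, the variable whose moments are the eigenvector. -/
def eigenBase (z : ℝ × ℝ) : ℝ := 1 - z.2 / ((1 + z.2) * (1 + z.1))

theorem measurable_eigenBase : Measurable eigenBase := by unfold eigenBase; fun_prop

theorem eigenBase_pos {u t : ℝ} (hu : 0 < u) (ht : 0 < t) : 0 < eigenBase (u, t) := by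
  rw [eigenBase, sub_pos, div_lt_one (by positivity)]
  simp only
  nlinarith [mul_pos hu ht]

theorem eigenBase_lt_one {u t : ℝ} (hu : 0 < u) (ht : 0 < t) : eigenBase (u, t) < 1 := by
  rw [eigenBase]
  have : 0 < t / ((1 + t) * (1 + u)) := by positivity
  simpa using this

/-- The (unnormalised) generalised eigenvector of the Hilbert matrix for the eigenvalue
`π / sin (π s)`. -/
def eigenSeq (s : ℝ) (n : ℕ) : ℝ :=
  ∫ z, eigenBase z ^ n ∂(betaPrimeMeasure s).prod (betaPrimeMeasure s)

theorem ae_eigenBase_mem (s : ℝ) :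
    ∀ᵐ z ∂(betaPrimeMeasure s).prod (betaPrimeMeasure s), 0 ≤ eigenBase z ∧ eigenBase z < 1 := by
  filter_upwards [ae_pos_betaPrimeMeasure_prod s] with z hz
  exact ⟨(eigenBase_pos hz.1 hz.2).le, eigenBase_lt_one hz.1 hz.2⟩

theorem integrable_eigenBase_pow {s : ℝ} (h0 : 0 < s) (h1 : s < 1) (n : ℕ) :
    Integrable (fun z => eigenBase z ^ n) ((betaPrimeMeasure s).prod (betaPrimeMeasure s)) := by
  have := isFiniteMeasure_betaPrimeMeasure h0 h1
  refine Integrable.of_bound (measurable_eigenBase.pow_const n).aestronglyMeasurable 1 ?_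
  filter_upwards [ae_eigenBase_mem s] with z hz
  rw [Real.norm_eq_abs, abs_of_nonneg (pow_nonneg hz.1 n)]
  exact pow_le_one₀ hz.1 hz.2.le

theorem ofReal_eigenSeq {s : ℝ} (h0 : 0 < s) (h1 : s < 1) (n : ℕ) :
    ENNReal.ofReal (eigenSeq s n) =
      ∫⁻ z, ENNReal.ofReal (eigenBase z ^ n) ∂(betaPrimeMeasure s).prod (betaPrimeMeasure s) := by
  refine ofReal_integral_eq_lintegral_ofReal (integrable_eigenBase_pow h0 h1 n) ?_
  filter_upwards [ae_eigenBase_mem s] with z hz using pow_nonneg hz.1 n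

theorem eigenSeq_nonneg (s : ℝ) (n : ℕ) : 0 ≤ eigenSeq s n := by
  refine integral_nonneg_of_ae ?_
  filter_upwards [ae_eigenBase_mem s] with z hz using pow_nonneg hz.1 n

theorem tsum_ofReal_eigenSeq {s : ℝ} (h0 : 0 < s) (h1 : s < 1) (n : ℕ) :
    ∑' m : ℕ, ENNReal.ofReal (eigenSeq s m / (n + m + 1)) =
      ENNReal.ofReal (Real.pi / Real.sin (Real.pi * s) * eigenSeq s n) := by
  have hB : 0 ≤ Real.pi / Real.sin (Real.pi * s) :=
    div_nonneg Real.pi_pos.le (Real.sin_nonneg_of_nonneg_of_le_pi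
      (by have := Real.pi_pos; positivity) (by nlinarith [Real.pi_pos]))
  have hterm : ∀ m : ℕ, ENNReal.ofReal (eigenSeq s m / (n + m + 1)) =
      ∫⁻ w in Set.Ioi (0 : ℝ), ∫⁻ z, ENNReal.ofReal ((w / (1 + w)) ^ n / (1 + w) ^ 2 *
        (eigenBase z * (w / (1 + w))) ^ m) ∂(betaPrimeMeasure s).prod (betaPrimeMeasure s) := by
    intro m
    have h := lintegral_div_one_add_pow (n + m)
    push_cast at h
    rw [div_eq_mul_one_div, ENNReal.ofReal_mul (eigenSeq_nonneg s m), ← h,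
      ofReal_eigenSeq h0 h1, ← lintegral_const_mul _ (by fun_prop)]
    refine setLIntegral_congr_fun measurableSet_Ioi fun w (hw : 0 < w) => ?_
    rw [← lintegral_mul_const _ (measurable_eigenBase.pow_const m).ennreal_ofReal]
    refine lintegral_congr_ae ?_
    filter_upwards [ae_eigenBase_mem s] with z hz
    rw [← ENNReal.ofReal_mul (pow_nonneg hz.1 m)]
    congr 1
    ring
  have hme := measurable_eigenBase
  rw [tsum_congr hterm, ← lintegral_tsum (fun m => (Measurable.lintegral_prod_right
    (f := fun w z => ENNReal.ofReal ((w / (1 + w)) ^ n / (1 + w) ^ 2 *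
        (eigenBase z * (w / (1 + w))) ^ m)) (by fun_prop)).aemeasurable),
    ENNReal.ofReal_mul hB, ofReal_eigenSeq h0 h1, lintegral_betaPrimeMeasure_prod s
      (hme.pow_const n) (fun u t hu ht => pow_nonneg (eigenBase_pos hu ht).le n)]
  refine Eq.trans ?_ ((lintegral_resolvent_eq_mehlerKernel h0 h1 n).trans
    (congrArg _ (lintegral_pow_mul_eq_mehlerKernel s n).symm))
  refine setLIntegral_congr_fun measurableSet_Ioi fun w (hw : 0 < w) => ?_
  rw [← lintegral_tsum (fun m => Measurable.aemeasurable (by fun_prop)),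
    lintegral_lintegral_swap (Measurable.aemeasurable (by fun_prop))]
  refine Eq.trans ?_ (lintegral_betaPrimeMeasure_prod s (f := fun z => (w / (1 + w)) ^ n /
    (1 + w) ^ 2 * (1 - eigenBase z * (w / (1 + w)))⁻¹) (by fun_prop) ?_)
  · refine lintegral_congr_ae ?_
    filter_upwards [ae_eigenBase_mem s] with z hz
    have hx0 : 0 ≤ w / (1 + w) := by positivity
    have hx1 : w / (1 + w) < 1 := by rw [div_lt_one (by positivity)]; linarith
    have hy0 := mul_nonneg hz.1 hx0
    have hy1 : eigenBase z * (w / (1 + w)) < 1 :=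
      mul_lt_one_of_nonneg_of_lt_one_left hz.1 hz.2 hx1.le
    have hg := (hasSum_geometric_of_lt_one hy0 hy1).mul_left ((w / (1 + w)) ^ n / (1 + w) ^ 2)
    rw [← hg.tsum_eq, ENNReal.ofReal_tsum_of_nonneg (fun m => by positivity) hg.summable]
  · intro u t hu ht
    have hx1 : w / (1 + w) < 1 := by rw [div_lt_one (by positivity)]; linarith
    have hy1 := mul_lt_one_of_nonneg_of_lt_one_left (eigenBase_pos hu ht).le
      (eigenBase_lt_one hu ht) hx1.le
    have := sub_pos.2 hy1
    positivity

theorem hasSum_eigenSeq {s : ℝ} (h0 : 0 < s) (h1 : s < 1) (n : ℕ) :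
    HasSum (fun m : ℕ => eigenSeq s m / (n + m + 1))
      (Real.pi / Real.sin (Real.pi * s) * eigenSeq s n) := by
  have hB : 0 ≤ Real.pi / Real.sin (Real.pi * s) :=
    div_nonneg Real.pi_pos.le (Real.sin_nonneg_of_nonneg_of_le_pi
      (by have := Real.pi_pos; positivity) (by nlinarith [Real.pi_pos]))
  have hnn : ∀ m : ℕ, 0 ≤ eigenSeq s m / (n + m + 1) :=
    fun m => div_nonneg (eigenSeq_nonneg s m) (by positivity)
  have h := tsum_ofReal_eigenSeq h0 h1 n
  have h2 := congrArg ENNReal.toReal h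
  rw [ENNReal.toReal_ofReal (mul_nonneg hB (eigenSeq_nonneg s n)),
    ENNReal.tsum_toReal_eq (fun m => ENNReal.ofReal_ne_top)] at h2
  simp only [ENNReal.toReal_ofReal (hnn _)] at h2
  rw [← h2]
  refine Summable.hasSum ?_
  have := ENNReal.summable_toReal (h ▸ ENNReal.ofReal_ne_top)
  simpa only [ENNReal.toReal_ofReal (hnn _)] using this

theorem antitone_eigenSeq {s : ℝ} (h0 : 0 < s) (h1 : s < 1) : Antitone (eigenSeq s) := by
  intro m n hmn
  refine integral_mono_ae (integrable_eigenBase_pow h0 h1 n) (integrable_eigenBase_pow h0 h1 m) ?_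
  filter_upwards [ae_eigenBase_mem s] with z hz using pow_le_pow_of_le_one hz.1 hz.2.le hmn

theorem tendsto_eigenSeq {s : ℝ} (h0 : 0 < s) (h1 : s < 1) :
    Tendsto (eigenSeq s) atTop (nhds 0) := by
  have := isFiniteMeasure_betaPrimeMeasure h0 h1
  have h := tendsto_integral_of_dominated_convergence
    (μ := (betaPrimeMeasure s).prod (betaPrimeMeasure s)) (F := fun n z => eigenBase z ^ n)
    (f := fun _ => 0) (fun _ => 1)
    (fun n => (measurable_eigenBase.pow_const n).aestronglyMeasurable) (integrable_const 1)
    (fun n => by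
      filter_upwards [ae_eigenBase_mem s] with z hz
      rw [Real.norm_eq_abs, abs_of_nonneg (pow_nonneg hz.1 n)]
      exact pow_le_one₀ hz.1 hz.2.le)
    (by
      filter_upwards [ae_eigenBase_mem s] with z hz
      exact tendsto_pow_atTop_nhds_zero_of_lt_one hz.1 hz.2)
  simp only [integral_zero] at h
  exact h

theorem abs_sndDiff_eigenSeq_le {s : ℝ} (h0 : 0 < s) (h1 : s < 1) (m : ℕ) :
    |(m + 1) * (eigenSeq s m - eigenSeq s (m + 1)) - m * (eigenSeq s (m - 1) - eigenSeq s m)| ≤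
      8 * eigenSeq s 0 / (m + 1) := by
  have hi := integrable_eigenBase_pow h0 h1
  have hij : ∀ i j : ℕ, Integrable (fun z => eigenBase z ^ i - eigenBase z ^ j)
      ((betaPrimeMeasure s).prod (betaPrimeMeasure s)) := fun i j => (hi i).sub (hi j)
  have heq : (m + 1) * (eigenSeq s m - eigenSeq s (m + 1)) -
      m * (eigenSeq s (m - 1) - eigenSeq s m) = ∫ z, ((m + 1) * (eigenBase z ^ m -
        eigenBase z ^ (m + 1)) - m * (eigenBase z ^ (m - 1) - eigenBase z ^ m))
        ∂(betaPrimeMeasure s).prod (betaPrimeMeasure s) := by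
    rw [integral_sub ((hij _ _).const_mul _) ((hij _ _).const_mul _),
      integral_const_mul, integral_const_mul, integral_sub (hi _) (hi _),
      integral_sub (hi _) (hi _)]
    rfl
  rw [heq, show 8 * eigenSeq s 0 / ((m : ℝ) + 1) = 8 / (m + 1) * eigenSeq s 0 by ring, eigenSeq,
    ← integral_const_mul, ← Real.norm_eq_abs]
  refine norm_integral_le_of_norm_le ((hi 0).const_mul _) ?_
  filter_upwards [ae_eigenBase_mem s] with z hz
  simpa using abs_sndDiff_pow_le hz.1 hz.2.le m

theorem integrable_div_one_add_betaPrimeMeasure {s : ℝ} (h0 : 0 < s) (h1 : s < 1) :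
    Integrable (fun t => t / (1 + t)) (betaPrimeMeasure s) := by
  have := isFiniteMeasure_betaPrimeMeasure h0 h1
  refine Integrable.of_bound (Measurable.aestronglyMeasurable (by fun_prop)) 1 ?_
  filter_upwards [ae_pos_betaPrimeMeasure s] with t ht
  rw [Real.norm_eq_abs, abs_of_nonneg (by positivity), div_le_one (by positivity)]
  linarith

theorem betaPrimeMeasure_real_univ {s : ℝ} (h0 : 0 < s) (h1 : s < 1) :
    (betaPrimeMeasure s).real Set.univ = Real.pi / Real.sin (Real.pi * s) := by
  have hB : 0 ≤ Real.pi / Real.sin (Real.pi * s) :=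
    div_nonneg Real.pi_pos.le (Real.sin_nonneg_of_nonneg_of_le_pi
      (by have := Real.pi_pos; positivity) (by nlinarith [Real.pi_pos]))
  rw [Measure.real, betaPrimeMeasure_univ h0 h1, ENNReal.toReal_ofReal hB]

theorem integral_div_one_add_betaPrimeMeasure {s : ℝ} (h0 : 0 < s) (h1 : s < 1) :
    ∫ t, t / (1 + t) ∂betaPrimeMeasure s = s * (Real.pi / Real.sin (Real.pi * s)) := by
  have := isFiniteMeasure_betaPrimeMeasure h0 h1
  have hfin : Integrable (fun t => s - t / (1 + t)) (betaPrimeMeasure s) :=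
    (integrable_const s).sub (integrable_div_one_add_betaPrimeMeasure h0 h1)
  have hzero : ∫ t, (s - t / (1 + t)) ∂betaPrimeMeasure s = 0 := by
    have hm : Measurable fun t : ℝ => ENNReal.ofReal (t ^ (s - 1) / (1 + t)) := by fun_prop
    have hlt : ∀ᵐ t ∂volume.restrict (Set.Ioi (0 : ℝ)),
        ENNReal.ofReal (t ^ (s - 1) / (1 + t)) < ∞ := ae_of_all _ fun t => ENNReal.ofReal_lt_top
    have hcongr : ∀ t ∈ Set.Ioi (0 : ℝ), (ENNReal.ofReal (t ^ (s - 1) / (1 + t))).toReal •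
        (s - t / (1 + t)) = (s - t / (1 + t)) * (t ^ (s - 1) / (1 + t)) := by
      intro t (ht : 0 < t)
      rw [ENNReal.toReal_ofReal (by positivity), smul_eq_mul, mul_comm]
    have hfin' := (integrable_withDensity_iff_integrable_smul' hm hlt).1 hfin
    rw [← IntegrableOn, integrableOn_congr_fun hcongr measurableSet_Ioi] at hfin'
    rw [betaPrimeMeasure, integral_withDensity_eq_integral_toReal_smul hm hlt,
      setIntegral_congr_fun measurableSet_Ioi hcongr]
    have hlim1 : Tendsto (fun t : ℝ => t ^ s / (1 + t)) atTop (nhds 0) := by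
      refine tendsto_of_tendsto_of_tendsto_of_le_of_le' tendsto_const_nhds
        (tendsto_rpow_neg_atTop (sub_pos.2 h1)) ?_ ?_
      · filter_upwards [eventually_gt_atTop 0] with t ht using by positivity
      · filter_upwards [eventually_gt_atTop 0] with t ht
        rw [neg_sub, Real.rpow_sub_one ht.ne']
        gcongr
        linarith
    have h := integral_Ioi_of_hasDerivAt_of_tendsto (f := fun t : ℝ => t ^ s / (1 + t)) (a := 0)
      (f' := fun t => (s - t / (1 + t)) * (t ^ (s - 1) / (1 + t))) (m := 0)
      (((Real.continuousAt_rpow_const 0 s (Or.inr h0.le)).div (by fun_prop)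
        (by norm_num)).continuousWithinAt) (fun t (ht : 0 < t) => ?_) hfin' hlim1
    · rw [h, Real.zero_rpow h0.ne', zero_div, sub_zero]
    · have ht1 : 1 + t ≠ 0 := by positivity
      refine ((Real.hasDerivAt_rpow_const (Or.inl ht.ne')).div
        ((hasDerivAt_id' t).const_add 1) ht1).congr_deriv ?_
      rw [Real.rpow_sub_one ht.ne']
      field_simp
  rw [integral_sub (integrable_const s) (integrable_div_one_add_betaPrimeMeasure h0 h1),
    integral_const, betaPrimeMeasure_real_univ h0 h1, smul_eq_mul] at hzero
  linarith

theorem eigenSeq_zero {s : ℝ} (h0 : 0 < s) (h1 : s < 1) :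
    eigenSeq s 0 = (Real.pi / Real.sin (Real.pi * s)) ^ 2 := by
  simp only [eigenSeq, pow_zero, integral_const, smul_eq_mul, mul_one]
  rw [← Set.univ_prod_univ, measureReal_prod_prod, betaPrimeMeasure_real_univ h0 h1, sq]

theorem eigenSeq_zero_sub_one {s : ℝ} (h0 : 0 < s) (h1 : s < 1) :
    eigenSeq s 0 - eigenSeq s 1 = s * (1 - s) * (Real.pi / Real.sin (Real.pi * s)) ^ 2 := by
  have := isFiniteMeasure_betaPrimeMeasure h0 h1
  have hi := integrable_div_one_add_betaPrimeMeasure h0 h1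
  have h2 : ∫ t, (1 - t / (1 + t)) ∂betaPrimeMeasure s =
      (1 - s) * (Real.pi / Real.sin (Real.pi * s)) := by
    rw [integral_sub (integrable_const 1) hi, integral_const, betaPrimeMeasure_real_univ h0 h1,
      integral_div_one_add_betaPrimeMeasure h0 h1, smul_eq_mul]
    ring
  rw [eigenSeq, eigenSeq, ← integral_sub (integrable_eigenBase_pow h0 h1 0)
    (integrable_eigenBase_pow h0 h1 1)]
  have h3 := integral_prod_mul (μ := betaPrimeMeasure s) (ν := betaPrimeMeasure s)
    (fun u : ℝ => 1 - u / (1 + u)) (fun t : ℝ => t / (1 + t))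
  rw [h2, integral_div_one_add_betaPrimeMeasure h0 h1] at h3
  refine Eq.trans (integral_congr_ae ?_) (h3.trans (by ring))
  filter_upwards [ae_pos_betaPrimeMeasure_prod s] with z hz
  have h4 : 1 + z.1 ≠ 0 := by linarith [hz.1]
  have h5 : 1 + z.2 ≠ 0 := by linarith [hz.2]
  simp only [eigenBase]
  field_simp
  ring

theorem hasSum_hankel_apply {α : ℕ → ℝ} {Γ : ℓ2 →L[ℂ] ℓ2} (hΓ : IsHankelOp α Γ) (F : ℓ2) (n : ℕ) :
    HasSum (fun m : ℕ => F m * (α (n + m) : ℂ)) (Γ F n) := by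
  have h := ((lp.hasSum_single ENNReal.ofNat_ne_top F).mapL Γ).mapL (innerSL ℂ (e n))
  have hv : ∀ G : ℓ2, ⟪e n, G⟫ = G n := fun G => by
    rw [e, lp.inner_single_left]; simp
  simp only [innerSL_apply_apply] at h
  rw [hv] at h
  convert! h using 2 with m
  have h1 : lp.single 2 m (F m) = F m • e m := by
    rw [e, ← lp.single_smul, smul_eq_mul, mul_one]
  have h2 : ⟪e n, Γ (e m)⟫ = (α (n + m) : ℂ) := by
    rw [← inner_conj_symm, hΓ m n, Complex.conj_ofReal, add_comm]
  rw [h1, map_smul, inner_smul_right, h2]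

theorem exists_hilbert_add_smul_eq {Γ : ℓ2 →L[ℂ] ℓ2}
    (hΓ : IsHankelOp (fun n => 1 / (n + 1)) Γ) {s : ℝ} (h0 : 0 < s) (h1 : s < 1) :
    ∃ F : ℓ2, (Γ + ((Real.pi / Real.sin (Real.pi * s) : ℝ) : ℂ) • (1 : ℓ2 →L[ℂ] ℓ2)) F =
        (((Real.pi / Real.sin (Real.pi * s)) ^ 2 : ℝ) : ℂ) • e 0 ∧
      F 0 = ((s * (1 - s) * (Real.pi / Real.sin (Real.pi * s)) ^ 2 : ℝ) : ℂ) := by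
  set c : ℝ := Real.pi / Real.sin (Real.pi * s) with hc
  let f : ℕ → ℝ := fun m => (m + 1) * (eigenSeq s m - eigenSeq s (m + 1)) -
    m * (eigenSeq s (m - 1) - eigenSeq s m)
  have hf : Memℓp (fun m => (f m : ℂ)) 2 := by
    refine memℓp_gen ?_
    have hsum : Summable fun m : ℕ => (8 * eigenSeq s 0) ^ 2 * (1 / ((m : ℝ) + 1) ^ 2) := by
      refine Summable.mul_left _ ?_
      have := (summable_nat_add_iff 1).2 (Real.summable_one_div_nat_pow.2 one_lt_two)
      exact_mod_cast this
    refine hsum.of_nonneg_of_le (fun m => by positivity) fun m => ?_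
    rw [ENNReal.toReal_ofNat, Real.rpow_ofNat, Complex.norm_real, Real.norm_eq_abs]
    refine (pow_le_pow_left₀ (abs_nonneg _) (abs_sndDiff_eigenSeq_le h0 h1 m) 2).trans_eq ?_
    rw [div_pow, div_eq_mul_one_div]
  refine ⟨⟨fun m => (f m : ℂ), hf⟩, ?_, ?_⟩
  · ext n
    have h := hasSum_hankel_apply hΓ ⟨fun m => (f m : ℂ), hf⟩ n
    have h2 := Complex.hasSum_ofReal.2 (hasSum_hilbert_sndDiff (tendsto_eigenSeq h0 h1)
      (antitone_eigenSeq h0 h1) (hasSum_eigenSeq h0 h1) n)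
    have h3 := h.unique (by
      convert! h2 using 2 with m
      simp [f]
      ring)
    simp only [add_apply, smul_apply,
      one_apply_eq_self, lp.coeFn_add, lp.coeFn_smul, Pi.add_apply, Pi.smul_apply, h3]
    rcases eq_or_ne n 0 with rfl | hn
    · simp [e, f, ← hc, eigenSeq_zero h0 h1]
    · simp [e, f, hn, ← hc]
  · have := eigenSeq_zero_sub_one h0 h1
    simp [f, this, ← hc]

theorem inner_inverse_hilbert_add_smul {Γ : ℓ2 →L[ℂ] ℓ2}
    (hΓ : IsHankelOp (fun n => 1 / (n + 1)) Γ) {s : ℝ} (h0 : 0 < s) (h1 : s < 1)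
    (hu : IsUnit (Γ + ((Real.pi / Real.sin (Real.pi * s) : ℝ) : ℂ) • (1 : ℓ2 →L[ℂ] ℓ2))) :
    ⟪e 0, (Ring.inverse (Γ + ((Real.pi / Real.sin (Real.pi * s) : ℝ) : ℂ) •
      (1 : ℓ2 →L[ℂ] ℓ2)) : ℓ2 →L[ℂ] ℓ2) (e 0)⟫ = s * (1 - s) := by
  obtain ⟨F, hF, hF0⟩ := exists_hilbert_add_smul_eq hΓ h0 h1
  have hs : 0 < Real.sin (Real.pi * s) := Real.sin_pos_of_pos_of_lt_pi
    (by have := Real.pi_pos; positivity) (by nlinarith [Real.pi_pos])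
  set c : ℝ := Real.pi / Real.sin (Real.pi * s) with hc
  have hc0 : c ≠ 0 := (div_pos Real.pi_pos hs).ne'
  have h := congrArg (Ring.inverse (Γ + (c : ℂ) • (1 : ℓ2 →L[ℂ] ℓ2)) : ℓ2 →L[ℂ] ℓ2) hF
  rw [← mul_apply_eq_comp, Ring.inverse_mul_cancel _ hu,
    one_apply_eq_self, map_smul] at h
  have h2 := congrArg (fun G : ℓ2 => ⟪e 0, G⟫) h
  simp only [inner_smul_right] at h2
  rw [show ⟪e 0, F⟫ = F 0 by rw [e, lp.inner_single_left]; simp, hF0] at h2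
  have hc2 : (c : ℂ) ≠ 0 := by exact_mod_cast hc0
  push_cast at h2
  refine mul_left_cancel₀ (pow_ne_zero 2 hc2) ?_
  rw [← h2]; ring

theorem cos_pi_mul_re_pos {s : ℂ} (hs : |s.re| < 1 / 2) : 0 < (Complex.cos (Real.pi * s)).re := by
  obtain ⟨h1, h2⟩ := abs_lt.1 hs
  have h : (Complex.cos (Real.pi * s)).re =
      Real.cos (Real.pi * s.re) * Real.cosh (Real.pi * s.im) := by
    rw [Complex.cos_eq, Complex.re_ofReal_mul, Complex.im_ofReal_mul, ← Complex.ofReal_cos,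
      ← Complex.ofReal_sin, ← Complex.ofReal_cosh, ← Complex.ofReal_sinh]
    simp [-Complex.ofReal_cos, -Complex.ofReal_sin, -Complex.ofReal_cosh, -Complex.ofReal_sinh]
  rw [h]
  refine mul_pos (Real.cos_pos_of_mem_Ioo ⟨?_, ?_⟩) (Real.cosh_pos _) <;> nlinarith [Real.pi_pos]

theorem pi_div_sin_sq_ne {s : ℂ} (hs : |s.re| < 1 / 2) (h0 : Complex.sin (Real.pi * s) ≠ 0) {t : ℝ}
    (ht : t ∈ Set.Icc 0 (Real.pi ^ 2)) : (Real.pi / Complex.sin (Real.pi * s)) ^ 2 ≠ (t : ℂ) := by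
  intro h
  have hp : (Real.pi : ℂ) ≠ 0 := by exact_mod_cast Real.pi_ne_zero
  have ht0 : t ≠ 0 := by
    rintro rfl
    exact pow_ne_zero 2 (div_ne_zero hp h0) (by simpa using h)
  have htp : 0 < t := lt_of_le_of_ne ht.1 ht0.symm
  have hsin : Complex.sin (Real.pi * s) ^ 2 = ((Real.pi ^ 2 / t : ℝ) : ℂ) := by
    have : (t : ℂ) ≠ 0 := by exact_mod_cast ht0
    push_cast
    field_simp at h ⊢
    rw [h]
  have hcos : Complex.cos (Real.pi * s) ^ 2 = ((1 - Real.pi ^ 2 / t : ℝ) : ℂ) := by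
    rw [Complex.cos_sq', hsin]; push_cast; ring
  have hle : 1 ≤ Real.pi ^ 2 / t := (one_le_div htp).2 ht.2
  have hre := congrArg Complex.re hcos
  have him := congrArg Complex.im hcos
  have hpos := cos_pi_mul_re_pos hs
  simp only [sq, Complex.mul_re, Complex.mul_im, Complex.ofReal_re, Complex.ofReal_im] at hre him
  have him0 : (Complex.cos (Real.pi * s)).im = 0 := by
    have : (Complex.cos (Real.pi * s)).re * (Complex.cos (Real.pi * s)).im = 0 := by linarith
    exact (mul_eq_zero.1 this).resolve_left hpos.ne'
  rw [him0] at hre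
  rw [sq] at hle
  nlinarith

theorem smul_one_add_mul_smul_one_sub {𝕜 A : Type*} [Field 𝕜] [Ring A] [Algebra 𝕜 A] (a : A)
    (p : 𝕜) {S : 𝕜} (hS : S ≠ 0) :
    (p • (1 : A) + S • a) * (p • (1 : A) + (-S) • a) =
      (-S ^ 2) • (a ^ 2 - (p / S) ^ 2 • (1 : A)) := by
  simp only [add_mul, mul_add, smul_mul_assoc, mul_smul_comm, one_mul, mul_one, smul_smul, sq,
    smul_sub]
  rw [show -(S * S) * (p / S * (p / S)) = -(p * p) by field_simp]
  module

theorem commute_smul_one_add {𝕜 A : Type*} [Field 𝕜] [Ring A] [Algebra 𝕜 A] (a : A) (p S : 𝕜) :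
    Commute (p • (1 : A) + S • a) (p • (1 : A) + (-S) • a) := by
  simp only [Commute, SemiconjBy, add_mul, mul_add, smul_mul_assoc, mul_smul_comm, one_mul, mul_one]
  module

theorem inverse_sq_sub_smul {𝕜 A : Type*} [Field 𝕜] [CharZero 𝕜] [Ring A] [Algebra 𝕜 A] (a : A)
    {p S : 𝕜} (hp : p ≠ 0) (hS : S ≠ 0) (h1 : IsUnit (p • (1 : A) + S • a))
    (h2 : IsUnit (p • (1 : A) + (-S) • a)) :
    Ring.inverse (a ^ 2 - (p / S) ^ 2 • (1 : A)) = (-S ^ 2 / (2 * p)) •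
      (Ring.inverse (p • (1 : A) + S • a) + Ring.inverse (p • (1 : A) + (-S) • a)) := by
  have hm := smul_one_add_mul_smul_one_sub a p hS
  have hc := commute_smul_one_add a p S
  have hsum : (p • (1 : A) + S • a) + (p • (1 : A) + (-S) • a) = (2 * p) • (1 : A) := by module
  have hS2 : -S ^ 2 ≠ 0 := neg_ne_zero.2 (pow_ne_zero 2 hS)
  have hu : IsUnit (a ^ 2 - (p / S) ^ 2 • (1 : A)) := by
    have h := h1.mul h2
    rw [hm] at h
    have h3 := ((IsUnit.mk0 _ (inv_ne_zero hS2)).map (algebraMap 𝕜 A)).mul h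
    rwa [← Algebra.smul_def, smul_smul, inv_mul_cancel₀ hS2, one_smul] at h3
  rw [← mul_one (Ring.inverse (a ^ 2 - (p / S) ^ 2 • (1 : A))),
    Ring.inverse_mul_eq_iff_eq_mul _ _ _ hu, show a ^ 2 - (p / S) ^ 2 • (1 : A) = (-S ^ 2)⁻¹ •
      ((p • (1 : A) + S • a) * (p • (1 : A) + (-S) • a)) by
        rw [hm, smul_smul, inv_mul_cancel₀ hS2, one_smul]]
  generalize p • (1 : A) + S • a = X at *
  generalize p • (1 : A) + (-S) • a = Y at *
  rw [smul_mul_smul_comm, mul_add, hc.eq, mul_assoc, Ring.mul_inverse_cancel _ h1, ← hc.eq,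
    mul_assoc, Ring.mul_inverse_cancel _ h2, mul_one, mul_one, add_comm Y X, hsum, smul_smul]
  rw [show (-S ^ 2)⁻¹ * (-S ^ 2 / (2 * p)) * (2 * p) = 1 by field_simp, one_smul]

theorem inverse_smul_one_add {𝕜 A : Type*} [Field 𝕜] [Ring A] [Algebra 𝕜 A] (a : A)
    {p S : 𝕜} (hS : S ≠ 0) (h1 : IsUnit (p • (1 : A) + S • a)) :
    IsUnit (a + (p / S) • (1 : A)) ∧
      Ring.inverse (a + (p / S) • (1 : A)) = S • Ring.inverse (p • (1 : A) + S • a) := by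
  have h : a + (p / S) • (1 : A) = S⁻¹ • (p • (1 : A) + S • a) := by
    rw [smul_add, smul_smul, smul_smul, inv_mul_cancel₀ hS, one_smul, add_comm, div_eq_inv_mul]
  have hu : IsUnit (a + (p / S) • (1 : A)) := by
    rw [h, Algebra.smul_def]
    exact ((IsUnit.mk0 _ (inv_ne_zero hS)).map (algebraMap 𝕜 A)).mul h1
  refine ⟨hu, ?_⟩
  rw [← mul_one (Ring.inverse (a + (p / S) • (1 : A))), Ring.inverse_mul_eq_iff_eq_mul _ _ _ hu, h,
    smul_mul_smul_comm, Ring.mul_inverse_cancel _ h1, inv_mul_cancel₀ hS, one_smul]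

theorem isUnit_hilbert_sin {Γ : ℓ2 →L[ℂ] ℓ2}
    (hinv : ∀ z : ℂ, (∀ t : ℝ, t ∈ Set.Icc (0 : ℝ) (Real.pi ^ 2) → z ≠ (t : ℂ)) →
      IsUnit (Γ ^ 2 - z • (1 : ℓ2 →L[ℂ] ℓ2))) {s : ℂ} (hs : |s.re| < 1 / 2) :
    IsUnit ((Real.pi : ℂ) • (1 : ℓ2 →L[ℂ] ℓ2) + Complex.sin (Real.pi * s) • Γ) := by
  have hp : (Real.pi : ℂ) ≠ 0 := by exact_mod_cast Real.pi_ne_zero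
  rcases eq_or_ne (Complex.sin (Real.pi * s)) 0 with h0 | h0
  · rw [h0, zero_smul, add_zero, ← Algebra.algebraMap_eq_smul_one]
    exact (IsUnit.mk0 _ hp).map (algebraMap ℂ (ℓ2 →L[ℂ] ℓ2))
  · have hu := hinv _ (fun t ht => pi_div_sin_sq_ne hs h0 ht)
    refine ((commute_smul_one_add Γ (Real.pi : ℂ) _).isUnit_mul_iff.1 ?_).1
    rw [smul_one_add_mul_smul_one_sub Γ _ h0, Algebra.smul_def]
    exact ((IsUnit.mk0 _ (neg_ne_zero.2 (pow_ne_zero 2 h0))).map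
      (algebraMap ℂ (ℓ2 →L[ℂ] ℓ2))).mul hu

theorem isPreconnected_abs_re_lt (r : ℝ) : IsPreconnected {s : ℂ | |s.re| < r} := by
  have h : {s : ℂ | |s.re| < r} = Complex.reLm ⁻¹' (Set.Ioo (-r) r) := by
    ext s; simp [abs_lt]
  rw [h]
  exact ((convex_Ioo _ _).linear_preimage Complex.reLm).isPreconnected

theorem frequently_ofReal_Ioo {p : ℂ → Prop} {r : ℝ} (hr : 0 < r)
    (h : ∀ x : ℝ, 0 < x → x < r → p x) : ∃ᶠ z in nhdsWithin (0 : ℂ) {0}ᶜ, p z := by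
  have ht : Tendsto (fun x : ℝ => (x : ℂ)) (nhdsWithin 0 (Set.Ioi 0)) (nhdsWithin 0 {0}ᶜ) := by
    refine tendsto_nhdsWithin_iff.2 ⟨?_, ?_⟩
    · exact (Complex.continuous_ofReal.tendsto' 0 0 (by simp)).mono_left nhdsWithin_le_nhds
    · filter_upwards [self_mem_nhdsWithin] with x (hx : 0 < x)
      simpa using hx.ne'
  refine ht.frequently (Eventually.frequently ?_)
  filter_upwards [Ioo_mem_nhdsGT hr] with x hx using h x hx.1 hx.2

theorem inner_inverse_hilbert_sin {Γ : ℓ2 →L[ℂ] ℓ2}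
    (hΓ : IsHankelOp (fun n => 1 / (n + 1)) Γ)
    (hinv : ∀ z : ℂ, (∀ t : ℝ, t ∈ Set.Icc (0 : ℝ) (Real.pi ^ 2) → z ≠ (t : ℂ)) →
      IsUnit (Γ ^ 2 - z • (1 : ℓ2 →L[ℂ] ℓ2))) {s : ℂ} (hs : |s.re| < 1 / 2) :
    Complex.sin (Real.pi * s) * ⟪e 0, (Ring.inverse ((Real.pi : ℂ) • (1 : ℓ2 →L[ℂ] ℓ2) +
      Complex.sin (Real.pi * s) • Γ) : ℓ2 →L[ℂ] ℓ2) (e 0)⟫ = s * (1 - s) := by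
  have hU : IsOpen {s : ℂ | |s.re| < 1 / 2} := by
    exact isOpen_lt (by fun_prop) continuous_const
  have hA : ∀ s : ℂ, AnalyticAt ℂ (fun s : ℂ => (Real.pi : ℂ) • (1 : ℓ2 →L[ℂ] ℓ2) +
      Complex.sin (Real.pi * s) • Γ) s := by
    intro s
    have : AnalyticAt ℂ (fun s : ℂ => Complex.sin (Real.pi * s)) s := by fun_prop
    exact analyticAt_const.add (this.smul analyticAt_const)
  have h := AnalyticOnNhd.eqOn_of_preconnected_of_frequently_eq (𝕜 := ℂ)
    (f := fun s => Complex.sin (Real.pi * s) * ⟪e 0, (Ring.inverse ((Real.pi : ℂ) •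
      (1 : ℓ2 →L[ℂ] ℓ2) + Complex.sin (Real.pi * s) • Γ) : ℓ2 →L[ℂ] ℓ2) (e 0)⟫)
    (g := fun s => s * (1 - s)) (U := {s : ℂ | |s.re| < 1 / 2}) (z₀ := 0) ?_ ?_
    (isPreconnected_abs_re_lt _) (by simp) (frequently_ofReal_Ioo one_half_pos ?_)
  · exact h hs
  · intro s hs
    obtain ⟨u, hu⟩ := isUnit_hilbert_sin hinv hs
    have h1 : AnalyticAt ℂ (fun s : ℂ => Ring.inverse ((Real.pi : ℂ) • (1 : ℓ2 →L[ℂ] ℓ2) +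
        Complex.sin (Real.pi * s) • Γ)) s := by
      refine AnalyticAt.fun_comp ?_ (hA s)
      rw [← hu]
      exact analyticAt_inverse u
    have h2 : AnalyticAt ℂ (fun s : ℂ => Complex.sin (Real.pi * s)) s := by fun_prop
    let L : (ℓ2 →L[ℂ] ℓ2) →L[ℂ] ℂ := (innerSL ℂ (e 0)) ∘L (ContinuousLinearMap.apply ℂ ℓ2 (e 0))
    exact h2.mul ((L.analyticAt _).fun_comp h1)
  · exact fun s _ => by fun_prop
  · intro x hx0 hx1
    have hsin : Real.sin (Real.pi * x) ≠ 0 := (Real.sin_pos_of_pos_of_lt_pi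
      (by have := Real.pi_pos; positivity) (by nlinarith [Real.pi_pos])).ne'
    have hsin' : Complex.sin (Real.pi * (x : ℂ)) ≠ 0 := by exact_mod_cast hsin
    have hu := isUnit_hilbert_sin hinv (s := (x : ℂ)) (by simpa [abs_of_pos hx0] using hx1)
    obtain ⟨hu2, hi⟩ := inverse_smul_one_add Γ hsin' hu
    have hcast : (Real.pi : ℂ) / Complex.sin (Real.pi * x) =
        ((Real.pi / Real.sin (Real.pi * x) : ℝ) : ℂ) := by push_cast; rfl
    rw [hcast] at hu2 hi
    have := inner_inverse_hilbert_add_smul hΓ hx0 (by linarith) hu2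
    rw [hi, smul_apply, inner_smul_right] at this
    exact this

/-- The resolvent of the squared Hilbert matrix at `(π / sin (π s)) ^ 2`. -/
theorem inner_inverse_hilbert_sq_sub {Γ : ℓ2 →L[ℂ] ℓ2}
    (hΓ : IsHankelOp (fun n => 1 / (n + 1)) Γ)
    (hinv : ∀ z : ℂ, (∀ t : ℝ, t ∈ Set.Icc (0 : ℝ) (Real.pi ^ 2) → z ≠ (t : ℂ)) →
      IsUnit (Γ ^ 2 - z • (1 : ℓ2 →L[ℂ] ℓ2))) {s : ℂ} (hs : |s.re| < 1 / 2)
    (h0 : Complex.sin (Real.pi * s) ≠ 0) :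
    ⟪e 0, (Ring.inverse (Γ ^ 2 - (Real.pi / Complex.sin (Real.pi * s)) ^ 2 • 1) :
      ℓ2 →L[ℂ] ℓ2) (e 0)⟫ = -(s * Complex.sin (Real.pi * s) / Real.pi) := by
  have hp : (Real.pi : ℂ) ≠ 0 := by exact_mod_cast Real.pi_ne_zero
  have hs' : |(-s).re| < 1 / 2 := by simpa using hs
  have hneg : Complex.sin (Real.pi * -s) = -Complex.sin (Real.pi * s) := by
    rw [mul_neg, Complex.sin_neg]
  have h1 := inner_inverse_hilbert_sin hΓ hinv hs
  have h2 := inner_inverse_hilbert_sin hΓ hinv hs'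
  have hu1 := isUnit_hilbert_sin hinv hs
  have hu2 := isUnit_hilbert_sin hinv hs'
  rw [hneg] at h2 hu2
  rw [inverse_sq_sub_smul Γ hp h0 hu1 hu2, smul_apply, add_apply, inner_smul_right, inner_add_right]
  generalize ⟪e 0, _⟫ = a at *
  generalize ⟪e 0, _⟫ = b at *
  generalize Complex.sin _ = S at *
  field_simp
  linear_combination h2 - h1

theorem sq_cpow_one_half (w : ℂ) : (w ^ (1 / 2 : ℂ)) ^ 2 = w := by
  rw [← Complex.cpow_nat_mul]; norm_num

theorem re_cpow_one_half_pos {w : ℂ} (hw : w ∈ Complex.slitPlane) : 0 < (w ^ (1 / 2 : ℂ)).re := by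
  have h1 := Complex.neg_pi_lt_arg w
  have h2 : w.arg < Real.pi :=
    lt_of_le_of_ne (Complex.arg_le_pi w) (Complex.mem_slitPlane_iff_arg.1 hw).1
  rw [Complex.cpow_def_of_ne_zero (Complex.slitPlane_ne_zero hw), Complex.exp_re]
  refine mul_pos (Real.exp_pos _) (Real.cos_pos_of_mem_Ioo ?_)
  have : (Complex.log w * (1 / 2)).im = w.arg / 2 := by
    rw [show (1 / 2 : ℂ) = ((1 / 2 : ℝ) : ℂ) by norm_num, Complex.im_mul_ofReal, Complex.log_im]
    ring
  rw [this]
  constructor <;> linarith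

theorem sinh_log_add_cpow {ζ : ℂ} (h : 0 < ζ.re) :
    Complex.sinh (Complex.log (ζ + (ζ ^ 2 + 1) ^ (1 / 2 : ℂ))) = ζ ∧
      |(Complex.log (ζ + (ζ ^ 2 + 1) ^ (1 / 2 : ℂ))).im| < Real.pi / 2 := by
  have hslit : ζ ^ 2 + 1 ∈ Complex.slitPlane := by
    rw [Complex.mem_slitPlane_iff]
    simp only [sq, Complex.add_re, Complex.mul_re, Complex.one_re, Complex.add_im, Complex.mul_im,
      Complex.one_im, add_zero]
    rcases eq_or_ne ζ.im 0 with h0 | h0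
    · left; rw [h0]; nlinarith
    · right
      rw [show ζ.re * ζ.im + ζ.im * ζ.re = 2 * (ζ.re * ζ.im) by ring]
      exact mul_ne_zero two_ne_zero (mul_ne_zero h.ne' h0)
  have hr := re_cpow_one_half_pos hslit
  have hsq := sq_cpow_one_half (ζ ^ 2 + 1)
  set r := (ζ ^ 2 + 1) ^ (1 / 2 : ℂ)
  have hE : 0 < (ζ + r).re := by rw [Complex.add_re]; linarith
  have hE0 : ζ + r ≠ 0 := fun h0 => by simp [h0] at hE
  constructor
  · rw [Complex.sinh, Complex.exp_neg, Complex.exp_log hE0]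
    have : (ζ + r)⁻¹ = r - ζ := by
      refine inv_eq_of_mul_eq_one_right ?_
      linear_combination hsq
    rw [this]; ring
  · rw [Complex.log_im]
    exact Complex.abs_arg_lt_pi_div_two_iff.2 (Or.inl hE)

theorem re_pi_div_cpow_pos {z : ℂ} (hz : ∀ t : ℝ, 0 ≤ t → z ≠ (t : ℂ)) :
    0 < ((Real.pi : ℂ) / (-z) ^ (1 / 2 : ℂ)).re := by
  have hslit : -z ∈ Complex.slitPlane := by
    rw [Complex.mem_slitPlane_iff]
    by_contra! h
    simp only [Complex.neg_re, Complex.neg_im, neg_eq_zero, Left.neg_nonpos_iff] at h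
    exact hz z.re h.1 (Complex.ext (by simp) (by simp [h.2]))
  have hq := re_cpow_one_half_pos hslit
  have hq0 : (-z) ^ (1 / 2 : ℂ) ≠ 0 := fun h0 => by rw [h0] at hq; simp at hq
  rw [Complex.div_re]
  simp only [Complex.ofReal_re, Complex.ofReal_im, zero_mul, zero_div, add_zero]
  have := Complex.normSq_pos.2 hq0
  have := Real.pi_pos
  positivity

/-- Every `z` off the positive half-line is `(π / sin (π s)) ^ 2` for an explicit `s`. -/
theorem sin_log_parametrization {z ζ W : ℂ} (hz : ∀ t : ℝ, 0 ≤ t → z ≠ (t : ℂ))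
    (hζ : ζ = (Real.pi : ℂ) / (-z) ^ (1 / 2 : ℂ))
    (hW : W = Complex.log (ζ + (ζ ^ 2 + 1) ^ (1 / 2 : ℂ))) :
    |(W * Complex.I / Real.pi).re| < 1 / 2 ∧
      Complex.sin (Real.pi * (W * Complex.I / Real.pi)) = ζ * Complex.I ∧ ζ ≠ 0 ∧
      (Real.pi / (ζ * Complex.I)) ^ 2 = z := by
  have hp : (Real.pi : ℂ) ≠ 0 := by exact_mod_cast Real.pi_ne_zero
  have hre : 0 < ζ.re := hζ ▸ re_pi_div_cpow_pos hz
  have hζ0 : ζ ≠ 0 := fun h0 => by simp [h0] at hre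
  obtain ⟨h1, h2⟩ := sinh_log_add_cpow hre
  rw [← hW] at h1 h2
  refine ⟨?_, ?_, hζ0, ?_⟩
  · have : (W * Complex.I / Real.pi).re = -W.im / Real.pi := by
      rw [Complex.div_ofReal_re]; simp
    rw [this, abs_div, abs_neg, abs_of_pos Real.pi_pos, div_lt_iff₀ Real.pi_pos]
    linarith
  · rw [mul_div_cancel₀ _ hp, Complex.sin_mul_I, h1]
  · have hq := sq_cpow_one_half (-z)
    have hq0 : (-z) ^ (1 / 2 : ℂ) ≠ 0 := fun h0 => hζ0 (by rw [hζ, h0, div_zero])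
    rw [hζ]
    generalize (-z) ^ (1 / 2 : ℂ) = q at *
    rw [div_pow, mul_pow, Complex.I_sq, div_pow]
    field_simp
    linear_combination -hq

theorem exists_sin_parametrization {z : ℂ}
    (hz : ∀ t : ℝ, t ∈ Set.Icc (0 : ℝ) (Real.pi ^ 2) → z ≠ (t : ℂ)) :
    ∃ s : ℂ, |s.re| < 1 / 2 ∧ Complex.sin (Real.pi * s) ≠ 0 ∧
      (Real.pi / Complex.sin (Real.pi * s)) ^ 2 = z := by
  have hp : (Real.pi : ℂ) ≠ 0 := by exact_mod_cast Real.pi_ne_zero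
  by_cases h : ∀ t : ℝ, 0 ≤ t → z ≠ (t : ℂ)
  · obtain ⟨h1, h2, h3, h4⟩ := sin_log_parametrization h rfl rfl
    refine ⟨_, h1, ?_, ?_⟩
    · rw [h2]; exact mul_ne_zero h3 Complex.I_ne_zero
    · rw [h2, h4]
  · push Not at h
    obtain ⟨t, ht0, rfl⟩ := h
    have ht : Real.pi ^ 2 < t := by
      by_contra! hle
      exact hz t ⟨ht0, hle⟩ rfl
    have hlt : Real.pi < Real.sqrt t := Real.lt_sqrt_of_sq_lt ht
    have hpos : 0 < Real.sqrt t := Real.pi_pos.trans hlt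
    have hx0 : 0 < Real.pi / Real.sqrt t := div_pos Real.pi_pos hpos
    have hx1 : Real.pi / Real.sqrt t < 1 := (div_lt_one hpos).2 hlt
    have hsin : Complex.sin (Real.pi * ((Real.arcsin (Real.pi / Real.sqrt t) / Real.pi : ℝ) : ℂ)) =
        ((Real.pi / Real.sqrt t : ℝ) : ℂ) := by
      rw [← Complex.ofReal_mul, mul_div_cancel₀ _ Real.pi_ne_zero, ← Complex.ofReal_sin,
        Real.sin_arcsin (by linarith) hx1.le]
    refine ⟨((Real.arcsin (Real.pi / Real.sqrt t) / Real.pi : ℝ) : ℂ), ?_, ?_, ?_⟩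
    · rw [Complex.ofReal_re, abs_of_pos (div_pos (Real.arcsin_pos.2 hx0) Real.pi_pos),
        div_lt_iff₀ Real.pi_pos]
      have := Real.arcsin_lt_pi_div_two.2 hx1
      linarith
    · rw [hsin]; exact_mod_cast hx0.ne'
    · rw [hsin, ← Complex.ofReal_div, ← Complex.ofReal_pow, div_div_cancel₀ Real.pi_ne_zero,
        Real.sq_sqrt ht0]

theorem neg_mul_inner_inverse_hilbert_sq {Γ : ℓ2 →L[ℂ] ℓ2}
    (hΓ : IsHankelOp (fun n => 1 / (n + 1)) Γ)
    (hinv : ∀ z : ℂ, (∀ t : ℝ, t ∈ Set.Icc (0 : ℝ) (Real.pi ^ 2) → z ≠ (t : ℂ)) →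
      IsUnit (Γ ^ 2 - z • (1 : ℓ2 →L[ℂ] ℓ2))) {z : ℂ} (hz : ∀ t : ℝ, 0 ≤ t → z ≠ (t : ℂ)) :
    -z * ⟪e 0, (Ring.inverse (Γ ^ 2 - z • 1) : ℓ2 →L[ℂ] ℓ2) (e 0)⟫ =
      Complex.log ((Real.pi : ℂ) / (-z) ^ (1 / 2 : ℂ) +
          (((Real.pi : ℂ) / (-z) ^ (1 / 2 : ℂ)) ^ 2 + 1) ^ (1 / 2 : ℂ)) /
        ((Real.pi : ℂ) / (-z) ^ (1 / 2 : ℂ)) := by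
  have hp : (Real.pi : ℂ) ≠ 0 := by exact_mod_cast Real.pi_ne_zero
  obtain ⟨h1, h2, h3, h4⟩ := sin_log_parametrization hz rfl rfl
  generalize (Real.pi : ℂ) / (-z) ^ (1 / 2 : ℂ) = ζ at *
  generalize Complex.log (ζ + (ζ ^ 2 + 1) ^ (1 / 2 : ℂ)) = W at *
  have hI : (ζ * Complex.I) ≠ 0 := mul_ne_zero h3 Complex.I_ne_zero
  have h5 := inner_inverse_hilbert_sq_sub hΓ hinv h1 (by rwa [h2])
  rw [h2, h4] at h5
  rw [h5, ← h4]
  have hI2 := Complex.I_sq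
  field_simp

theorem lintegral_Ioo_ofReal_deriv {f f' : ℝ → ℝ} {a b : ℝ} (hab : a ≤ b)
    (hf : ContinuousOn f (Set.Icc a b)) (hd : ∀ x ∈ Set.Ioo a b, HasDerivAt f (f' x) x)
    (hpos : ∀ x ∈ Set.Ioo a b, 0 ≤ f' x) :
    ∫⁻ x in Set.Ioo a b, ENNReal.ofReal (f' x) = ENNReal.ofReal (f b - f a) := by
  have hi := intervalIntegral.integrableOn_deriv_of_nonneg hf hd hpos
  rw [← intervalIntegral.integral_eq_sub_of_hasDerivAt_of_le hab hf hd
    ((intervalIntegrable_iff_integrableOn_Ioc_of_le hab).2 hi),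
    intervalIntegral.integral_of_le hab, integral_Ioc_eq_integral_Ioo,
    ofReal_integral_eq_lintegral_ofReal (hi.mono_set Set.Ioo_subset_Ioc_self)]
  filter_upwards [ae_restrict_mem measurableSet_Ioo] with x hx using hpos x hx

theorem lintegral_Ioo_triangle_swap {f : ℝ → ℝ → ℝ≥0∞} (hf : Measurable (Function.uncurry f)) :
    ∫⁻ y in Set.Ioo (0 : ℝ) 1, ∫⁻ w in Set.Ioo y 1, f y w =
      ∫⁻ w in Set.Ioo (0 : ℝ) 1, ∫⁻ y in Set.Ioo 0 w, f y w := by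
  let T : Set (ℝ × ℝ) := {z | 0 < z.1 ∧ z.1 < z.2 ∧ z.2 < 1}
  have hT : MeasurableSet T :=
    (measurableSet_lt measurable_const measurable_fst).inter
      ((measurableSet_lt measurable_fst measurable_snd).inter
        (measurableSet_lt measurable_snd measurable_const))
  have hg : Measurable (T.indicator (Function.uncurry f)) := hf.indicator hT
  have h1 : ∫⁻ y in Set.Ioo (0 : ℝ) 1, ∫⁻ w in Set.Ioo y 1, f y w =
      ∫⁻ y, ∫⁻ w, T.indicator (Function.uncurry f) (y, w) := by
    rw [← lintegral_indicator measurableSet_Ioo]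
    refine lintegral_congr fun y => ?_
    by_cases hy : y ∈ Set.Ioo (0 : ℝ) 1
    · rw [Set.indicator_of_mem hy, ← lintegral_indicator measurableSet_Ioo]
      refine lintegral_congr fun w => ?_
      simp only [Set.indicator_apply]
      congr 1
      simp [T, hy.1]
    · rw [Set.indicator_of_notMem hy]
      refine ((lintegral_congr fun w => ?_).trans lintegral_zero).symm
      refine Set.indicator_of_notMem (fun hm => hy ?_) _
      exact ⟨hm.1, hm.2.1.trans hm.2.2⟩
  have h2 : ∫⁻ w in Set.Ioo (0 : ℝ) 1, ∫⁻ y in Set.Ioo 0 w, f y w =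
      ∫⁻ w, ∫⁻ y, T.indicator (Function.uncurry f) (y, w) := by
    rw [← lintegral_indicator measurableSet_Ioo]
    refine lintegral_congr fun w => ?_
    by_cases hw : w ∈ Set.Ioo (0 : ℝ) 1
    · rw [Set.indicator_of_mem hw, ← lintegral_indicator measurableSet_Ioo]
      refine lintegral_congr fun y => ?_
      simp only [Set.indicator_apply]
      congr 1
      simp [T, hw.2]
    · rw [Set.indicator_of_notMem hw]
      refine ((lintegral_congr fun y => ?_).trans lintegral_zero).symm
      refine Set.indicator_of_notMem (fun hm => hw ?_) _
      exact ⟨hm.1.trans hm.2.1, hm.2.2⟩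
  rw [h1, h2]
  exact lintegral_lintegral_swap (f := fun y w => T.indicator (Function.uncurry f) (y, w))
    hg.aemeasurable

theorem lintegral_inv_sqrt_sq_sub_sq {y : ℝ} (h0 : 0 < y) (h1 : y < 1) :
    ∫⁻ w in Set.Ioo y 1, ENNReal.ofReal (1 / Real.sqrt (w ^ 2 - y ^ 2)) =
      ENNReal.ofReal (Real.log (1 / y + Real.sqrt (1 / y ^ 2 - 1))) := by
  have hlog : Real.log (1 / y + Real.sqrt (1 / y ^ 2 - 1)) =
      Real.log (1 + Real.sqrt (1 ^ 2 - y ^ 2)) - Real.log (y + Real.sqrt (y ^ 2 - y ^ 2)) := by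
    rw [sub_self, Real.sqrt_zero, add_zero, ← Real.log_div (by positivity) h0.ne', add_div,
      show 1 / y ^ 2 - 1 = (1 ^ 2 - y ^ 2) / y ^ 2 by field_simp, Real.sqrt_div' _ (by positivity),
      Real.sqrt_sq h0.le]
  rw [hlog]
  refine lintegral_Ioo_ofReal_deriv (f := fun w => Real.log (w + Real.sqrt (w ^ 2 - y ^ 2))) h1.le
    ?_ (fun w hw => ?_) (fun w _ => by positivity)
  · refine ContinuousOn.log (by fun_prop) fun w hw => ?_
    have : 0 < w := h0.trans_le hw.1
    positivity
  · have hw0 : 0 < w := h0.trans hw.1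
    have hq : 0 < w ^ 2 - y ^ 2 := by nlinarith [hw.1]
    have hs : 0 < Real.sqrt (w ^ 2 - y ^ 2) := Real.sqrt_pos.2 hq
    have hd : HasDerivAt (fun w => w + Real.sqrt (w ^ 2 - y ^ 2)) _ w :=
      (hasDerivAt_id' w).add (((hasDerivAt_pow 2 w).sub_const (y ^ 2)).sqrt hq.ne')
    refine (hd.log (by positivity)).congr_deriv ?_
    simp only [Nat.cast_ofNat, Nat.add_one_sub_one, pow_one]
    field_simp
    ring

theorem lintegral_inv_sqrt_mul {w σ : ℝ} (hw0 : 0 < w) (hw1 : w < 1) (hσ0 : 0 < σ) (hσ1 : σ < 1) :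
    ∫⁻ y in Set.Ioo 0 w, ENNReal.ofReal (1 / (Real.sqrt (w ^ 2 - y ^ 2) * (1 - σ ^ 2 * y ^ 2))) =
      ENNReal.ofReal (Real.pi / 2 * (1 / Real.sqrt (1 - (σ * w) ^ 2))) := by
  have hσw : σ * w < 1 := by nlinarith
  have ha2 : 0 < 1 - (σ * w) ^ 2 := by
    have := mul_pos hσ0 hw0
    nlinarith
  have ha := Real.sqrt_pos.2 ha2
  have hasq := Real.sq_sqrt ha2.le
  set a := Real.sqrt (1 - (σ * w) ^ 2) with hadef
  have hr2 : ∀ y ∈ Set.Icc 0 w, 0 < 1 - σ ^ 2 * y ^ 2 := by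
    intro y hy
    have : (σ * y) ^ 2 ≤ (σ * w) ^ 2 := pow_le_pow_left₀ (mul_nonneg hσ0.le hy.1)
      (mul_le_mul_of_nonneg_left hy.2 hσ0.le) 2
    nlinarith
  have h := lintegral_Ioo_ofReal_deriv (a := 0) (b := w)
    (f := fun y => Real.arcsin (a * y / (w * Real.sqrt (1 - σ ^ 2 * y ^ 2))) / a)
    (f' := fun y => 1 / (Real.sqrt (w ^ 2 - y ^ 2) * (1 - σ ^ 2 * y ^ 2))) hw0.le ?_ ?_ ?_
  · rw [h]
    congr 1
    have : a * w / (w * Real.sqrt (1 - σ ^ 2 * w ^ 2)) = 1 := by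
      rw [← mul_pow, ← hadef]; field_simp
    simp only [this]
    simp
    ring
  · refine ContinuousOn.div_const (Real.continuous_arcsin.comp_continuousOn ?_) a
    refine ContinuousOn.div (by fun_prop) (by fun_prop) fun y hy => ?_
    exact (mul_pos hw0 (Real.sqrt_pos.2 (hr2 y hy))).ne'
  · intro y hy
    have hr20 := hr2 y ⟨hy.1.le, hy.2.le⟩
    have hr := Real.sqrt_pos.2 hr20
    have hrsq := Real.sq_sqrt hr20.le
    have hq20 : 0 < w ^ 2 - y ^ 2 := by nlinarith [hy.1, hy.2]
    have hq := Real.sqrt_pos.2 hq20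
    have hqsq := Real.sq_sqrt hq20.le
    have hdr := ((((hasDerivAt_pow 2 y).const_mul (σ ^ 2)).const_sub 1).sqrt hr20.ne').const_mul w
    have hdu := ((hasDerivAt_id' y).const_mul a).div hdr (mul_pos hw0 hr).ne'
    set r := Real.sqrt (1 - σ ^ 2 * y ^ 2) with hrdef
    set q := Real.sqrt (w ^ 2 - y ^ 2) with hqdef
    have hu : 1 - (a * y / (w * r)) ^ 2 = (q / (w * r)) ^ 2 := by
      rw [div_pow, div_pow, mul_pow, mul_pow, hasq, hqsq, hrsq]
      field_simp
      ring
    have hupos : 0 < (q / (w * r)) ^ 2 := by positivity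
    have hne1 : a * y / (w * r) ≠ -1 := fun h => by rw [← hu, h] at hupos; norm_num at hupos
    have hne2 : a * y / (w * r) ≠ 1 := fun h => by rw [← hu, h] at hupos; norm_num at hupos
    refine (((Real.hasDerivAt_arcsin hne1 hne2).comp y hdu).div_const a).congr_deriv ?_
    rw [hu, Real.sqrt_sq (by positivity), ← hrsq]
    simp only [Nat.cast_ofNat, Nat.add_one_sub_one, pow_one]
    field_simp
    rw [hrsq]
    ring
  · intro y hy
    have := hr2 y ⟨hy.1.le, hy.2.le⟩
    positivity

theorem lintegral_inv_sqrt_one_sub {σ : ℝ} (hσ0 : 0 < σ) (hσ1 : σ < 1) :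
    ∫⁻ w in Set.Ioo (0 : ℝ) 1, ENNReal.ofReal (1 / Real.sqrt (1 - (σ * w) ^ 2)) =
      ENNReal.ofReal (Real.arcsin σ / σ) := by
  have h := lintegral_Ioo_ofReal_deriv (a := 0) (b := 1) (f := fun w => Real.arcsin (σ * w) / σ)
    (f' := fun w => 1 / Real.sqrt (1 - (σ * w) ^ 2)) zero_le_one
    (((Real.continuous_arcsin.comp (continuous_const.mul continuous_id)).div_const σ).continuousOn)
    (fun w hw => ?_) (fun w _ => by positivity)
  · simpa using h
  · have h0 : 0 < σ * w := mul_pos hσ0 hw.1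
    have h1 : σ * w < 1 := by nlinarith [hw.2]
    refine (((Real.hasDerivAt_arcsin (by linarith) h1.ne).comp w
      ((hasDerivAt_id' w).const_mul σ)).div_const σ).congr_deriv ?_
    field_simp

/-- The density of the spectral measure of the squared Hilbert matrix at `e 0`. -/
def hilbertDensity (l : ℝ) : ℝ :=
  1 / (Real.pi ^ 2 * Real.sqrt l) *
    Real.log (Real.pi / Real.sqrt l + Real.sqrt (Real.pi ^ 2 / l - 1))

theorem measurable_hilbertDensity : Measurable hilbertDensity := by
  unfold hilbertDensity; fun_prop

theorem hilbertDensity_nonneg {l : ℝ} (hl : l ∈ Set.Ioo 0 (Real.pi ^ 2)) :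
    0 ≤ hilbertDensity l := by
  have h0 := Real.sqrt_pos.2 hl.1
  have h1 : 1 ≤ Real.pi / Real.sqrt l := by
    rw [one_le_div h0, Real.sqrt_le_left Real.pi_pos.le]
    exact hl.2.le
  have := Real.log_nonneg
    (h1.trans (le_add_of_nonneg_right (Real.sqrt_nonneg (Real.pi ^ 2 / l - 1))))
  unfold hilbertDensity
  positivity

theorem image_pi_mul_sq_Ioo :
    (fun y : ℝ => (Real.pi * y) ^ 2) '' Set.Ioo 0 1 = Set.Ioo 0 (Real.pi ^ 2) := by
  have hp := Real.pi_pos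
  ext l
  constructor
  · rintro ⟨y, ⟨h0, h1⟩, rfl⟩
    exact ⟨by positivity, pow_lt_pow_left₀ (by nlinarith) (by positivity) two_ne_zero⟩
  · rintro ⟨h0, h1⟩
    have hs := Real.sqrt_pos.2 h0
    refine ⟨Real.sqrt l / Real.pi, ⟨by positivity, ?_⟩, ?_⟩
    · rw [div_lt_one hp, Real.sqrt_lt' hp]; exact h1
    · simp only
      rw [mul_div_cancel₀ _ hp.ne', Real.sq_sqrt h0.le]

theorem lintegral_hilbertDensity_div {σ : ℝ} (hσ0 : 0 < σ) (hσ1 : σ < 1) :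
    ∫⁻ l in Set.Ioo 0 (Real.pi ^ 2),
      ENNReal.ofReal (hilbertDensity l * (Real.pi ^ 2 - l * σ ^ 2)⁻¹) =
      ENNReal.ofReal (Real.arcsin σ / (Real.pi ^ 2 * σ)) := by
  have hp := Real.pi_pos
  have hd : ∀ y : ℝ, HasDerivAt (fun y : ℝ => (Real.pi * y) ^ 2) (2 * Real.pi ^ 2 * y) y :=
    fun y => (((hasDerivAt_id' y).const_mul Real.pi).pow 2).congr_deriv (by simp; ring)
  rw [← image_pi_mul_sq_Ioo, lintegral_image_eq_lintegral_abs_deriv_mul measurableSet_Ioo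
    (fun y _ => (hd y).hasDerivWithinAt) (fun x hx y hy h => by
      have := (pow_left_inj₀ (mul_nonneg hp.le hx.1.le) (mul_nonneg hp.le hy.1.le) two_ne_zero).1 h
      exact mul_left_cancel₀ hp.ne' this)]
  have hmeas : Measurable (Function.uncurry fun y w : ℝ => ENNReal.ofReal
      (1 / (Real.sqrt (w ^ 2 - y ^ 2) * (1 - σ ^ 2 * y ^ 2)))) := by
    unfold Function.uncurry; fun_prop
  calc _ = ∫⁻ y in Set.Ioo (0 : ℝ) 1, ENNReal.ofReal (2 / Real.pi ^ 3) *
        ∫⁻ w in Set.Ioo y 1, ENNReal.ofReal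
          (1 / (Real.sqrt (w ^ 2 - y ^ 2) * (1 - σ ^ 2 * y ^ 2))) := by
        refine setLIntegral_congr_fun measurableSet_Ioo fun y hy => ?_
        have hy0 := hy.1
        have hσy : 0 < 1 - σ ^ 2 * y ^ 2 := by
          have h0 : 0 < σ * y := mul_pos hσ0 hy0
          have h1 : σ * y < 1 := by nlinarith [hy.2]
          nlinarith
        have hfac : ∀ w : ℝ, ENNReal.ofReal
            (1 / (Real.sqrt (w ^ 2 - y ^ 2) * (1 - σ ^ 2 * y ^ 2))) =
            ENNReal.ofReal (1 / Real.sqrt (w ^ 2 - y ^ 2)) *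
              ENNReal.ofReal (1 / (1 - σ ^ 2 * y ^ 2)) := fun w => by
          rw [← ENNReal.ofReal_mul (by positivity), one_div_mul_one_div]
        simp only [hfac]
        rw [lintegral_mul_const _ (by fun_prop), lintegral_inv_sqrt_sq_sub_sq hy0 hy.2,
          ← ENNReal.ofReal_mul (abs_nonneg _), ← ENNReal.ofReal_mul' (one_div_pos.2 hσy).le,
          ← ENNReal.ofReal_mul (by positivity), abs_of_pos (by positivity), hilbertDensity,
          Real.sqrt_sq (by positivity)]
        congr 1
        rw [show Real.pi / (Real.pi * y) = 1 / y by field_simp,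
          show Real.pi ^ 2 / (Real.pi * y) ^ 2 = 1 / y ^ 2 by field_simp,
          show Real.pi ^ 2 - (Real.pi * y) ^ 2 * σ ^ 2 = Real.pi ^ 2 * (1 - σ ^ 2 * y ^ 2) by ring]
        field_simp
    _ = ENNReal.ofReal (2 / Real.pi ^ 3) * ∫⁻ w in Set.Ioo (0 : ℝ) 1, ∫⁻ y in Set.Ioo 0 w,
        ENNReal.ofReal (1 / (Real.sqrt (w ^ 2 - y ^ 2) * (1 - σ ^ 2 * y ^ 2))) := by
        rw [lintegral_const_mul' _ _ ENNReal.ofReal_ne_top, lintegral_Ioo_triangle_swap hmeas]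
    _ = ENNReal.ofReal (2 / Real.pi ^ 3) * ∫⁻ w in Set.Ioo (0 : ℝ) 1,
        ENNReal.ofReal (Real.pi / 2) * ENNReal.ofReal (1 / Real.sqrt (1 - (σ * w) ^ 2)) := by
        congr 1
        refine setLIntegral_congr_fun measurableSet_Ioo fun w hw => ?_
        rw [lintegral_inv_sqrt_mul hw.1 hw.2 hσ0 hσ1, ENNReal.ofReal_mul (by positivity)]
    _ = _ := by
        rw [lintegral_const_mul' _ _ ENNReal.ofReal_ne_top, lintegral_inv_sqrt_one_sub hσ0 hσ1,
          ← ENNReal.ofReal_mul (by positivity), ← ENNReal.ofReal_mul (by positivity)]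
        congr 1
        field_simp

theorem integrableOn_hilbertDensity :
    IntegrableOn hilbertDensity (Set.Ioo 0 (Real.pi ^ 2)) := by
  refine ⟨measurable_hilbertDensity.aestronglyMeasurable, ?_⟩
  have hp := Real.pi_pos
  rw [hasFiniteIntegral_iff_ofReal
    ((ae_restrict_mem measurableSet_Ioo).mono fun l hl => hilbertDensity_nonneg hl)]
  have h : ∫⁻ l in Set.Ioo 0 (Real.pi ^ 2), ENNReal.ofReal (hilbertDensity l) ≤
      ∫⁻ l in Set.Ioo 0 (Real.pi ^ 2), ENNReal.ofReal (Real.pi ^ 2) *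
        ENNReal.ofReal (hilbertDensity l * (Real.pi ^ 2 - l * (1 / 2) ^ 2)⁻¹) := by
    refine setLIntegral_mono' measurableSet_Ioo fun l hl => ?_
    rw [← ENNReal.ofReal_mul (by positivity)]
    refine ENNReal.ofReal_le_ofReal ?_
    have h0 := hilbertDensity_nonneg hl
    have hq : 0 < Real.pi ^ 2 - l * (1 / 2) ^ 2 := by nlinarith [hl.1, hl.2]
    have h1 : 1 ≤ Real.pi ^ 2 * (Real.pi ^ 2 - l * (1 / 2) ^ 2)⁻¹ := by
      rw [← div_eq_mul_inv, one_le_div hq]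
      linarith [hl.1]
    nlinarith
  refine h.trans_lt ?_
  rw [lintegral_const_mul' _ _ ENNReal.ofReal_ne_top,
    lintegral_hilbertDensity_div one_half_pos one_half_lt_one]
  exact ENNReal.mul_lt_top ENNReal.ofReal_lt_top ENNReal.ofReal_lt_top

theorem differentiableAt_integral_hilbertDensity {u : ℂ}
    (hu : ∀ l ∈ Set.Icc 0 (Real.pi ^ 2), (Real.pi : ℂ) ^ 2 - l * u ≠ 0) :
    DifferentiableAt ℂ (fun u : ℂ => ∫ l in Set.Ioo 0 (Real.pi ^ 2),
      (hilbertDensity l : ℂ) * ((Real.pi : ℂ) ^ 2 - l * u)⁻¹) u := by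
  have hp := Real.pi_pos
  obtain ⟨l₀, hl₀, hmin⟩ := isCompact_Icc.exists_isMinOn
    (Set.nonempty_Icc.2 (by positivity : (0 : ℝ) ≤ Real.pi ^ 2))
    (f := fun l : ℝ => ‖(Real.pi : ℂ) ^ 2 - l * u‖) (by fun_prop)
  set δ := ‖(Real.pi : ℂ) ^ 2 - l₀ * u‖ with hδ
  have hδ0 : 0 < δ := norm_pos_iff.2 (hu l₀ hl₀)
  have hball : ∀ l ∈ Set.Ioo 0 (Real.pi ^ 2), ∀ v ∈ Metric.ball u (δ / (2 * Real.pi ^ 2)),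
      δ / 2 ≤ ‖(Real.pi : ℂ) ^ 2 - l * v‖ := by
    intro l hl v hv
    have h1 : δ ≤ ‖(Real.pi : ℂ) ^ 2 - l * u‖ := hmin ⟨hl.1.le, hl.2.le⟩
    have h2 : ‖(l : ℂ) * (v - u)‖ ≤ δ / 2 := by
      rw [norm_mul, Complex.norm_real, Real.norm_of_nonneg hl.1.le]
      calc l * ‖v - u‖ ≤ Real.pi ^ 2 * (δ / (2 * Real.pi ^ 2)) :=
            mul_le_mul hl.2.le (mem_ball_iff_norm.1 hv).le (norm_nonneg _) (by positivity)
        _ = δ / 2 := by field_simp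
    have h3 : (Real.pi : ℂ) ^ 2 - l * u = ((Real.pi : ℂ) ^ 2 - l * v) + l * (v - u) := by ring
    have h4 := norm_add_le ((Real.pi : ℂ) ^ 2 - l * v) (l * (v - u))
    rw [← h3] at h4
    linarith
  have hmeas : ∀ v : ℂ, Measurable fun l : ℝ =>
      (hilbertDensity l : ℂ) * ((Real.pi : ℂ) ^ 2 - l * v)⁻¹ := fun v =>
    (Complex.measurable_ofReal.comp measurable_hilbertDensity).mul (by fun_prop)
  refine (hasDerivAt_integral_of_dominated_loc_of_deriv_le
    (μ := volume.restrict (Set.Ioo 0 (Real.pi ^ 2)))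
    (F := fun v (l : ℝ) => (hilbertDensity l : ℂ) * ((Real.pi : ℂ) ^ 2 - l * v)⁻¹)
    (F' := fun v (l : ℝ) => (hilbertDensity l : ℂ) * (l / ((Real.pi : ℂ) ^ 2 - l * v) ^ 2))
    (bound := fun l => hilbertDensity l * (Real.pi ^ 2 / (δ / 2) ^ 2))
    (Metric.ball_mem_nhds u (by positivity : 0 < δ / (2 * Real.pi ^ 2)))
    (Eventually.of_forall fun v => (hmeas v).aestronglyMeasurable) ?_ ?_ ?_
    (integrableOn_hilbertDensity.mul_const _) ?_).2.differentiableAt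
  · refine Integrable.mono' (integrableOn_hilbertDensity.mul_const (δ / 2)⁻¹)
      (hmeas u).aestronglyMeasurable ?_
    filter_upwards [ae_restrict_mem measurableSet_Ioo] with l hl
    rw [norm_mul, Complex.norm_real, Real.norm_of_nonneg (hilbertDensity_nonneg hl), norm_inv]
    gcongr
    · exact hilbertDensity_nonneg hl
    · exact hball l hl u (Metric.mem_ball_self (by positivity))
  · exact ((Complex.measurable_ofReal.comp measurable_hilbertDensity).mul
      (by fun_prop)).aestronglyMeasurable
  · filter_upwards [ae_restrict_mem measurableSet_Ioo] with l hl v hv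
    rw [norm_mul, Complex.norm_real, Real.norm_of_nonneg (hilbertDensity_nonneg hl), norm_div,
      norm_pow, Complex.norm_real, Real.norm_of_nonneg hl.1.le]
    gcongr
    · exact hilbertDensity_nonneg hl
    · exact hl.2.le
    · exact hball l hl v hv
  · filter_upwards [ae_restrict_mem measurableSet_Ioo] with l hl v hv
    have hne : (Real.pi : ℂ) ^ 2 - l * v ≠ 0 :=
      norm_pos_iff.1 ((half_pos hδ0).trans_le (hball l hl v hv))
    have hd : HasDerivAt (fun v : ℂ => (Real.pi : ℂ) ^ 2 - l * v) (-l) v :=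
      (((hasDerivAt_id' v).const_mul (l : ℂ)).const_sub _).congr_deriv (by simp)
    refine ((hd.inv hne).const_mul _).congr_deriv ?_
    rw [neg_neg]

theorem pi_sq_sub_mul_sin_sq_ne_zero {s : ℂ} (hs : |s.re| < 1 / 2) {l : ℝ}
    (hl : l ∈ Set.Icc 0 (Real.pi ^ 2)) :
    (Real.pi : ℂ) ^ 2 - l * Complex.sin (Real.pi * s) ^ 2 ≠ 0 := by
  by_cases h0 : Complex.sin (Real.pi * s) = 0
  · simp [h0, Real.pi_ne_zero]
  · intro h
    refine pi_div_sin_sq_ne hs h0 hl ?_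
    rw [div_pow, div_eq_iff (pow_ne_zero 2 h0), sub_eq_zero.1 h]

theorem integral_hilbertDensity_div {σ : ℝ} (hσ0 : 0 < σ) (hσ1 : σ < 1) :
    ∫ l in Set.Ioo 0 (Real.pi ^ 2), (hilbertDensity l : ℂ) *
      ((Real.pi : ℂ) ^ 2 - l * (σ : ℂ) ^ 2)⁻¹ = (Real.arcsin σ / (Real.pi ^ 2 * σ) : ℝ) := by
  have hp := Real.pi_pos
  have h : ∫ l in Set.Ioo 0 (Real.pi ^ 2), hilbertDensity l * (Real.pi ^ 2 - l * σ ^ 2)⁻¹ =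
      Real.arcsin σ / (Real.pi ^ 2 * σ) := by
    rw [integral_eq_lintegral_of_nonneg_ae, lintegral_hilbertDensity_div hσ0 hσ1,
      ENNReal.toReal_ofReal]
    · have := Real.arcsin_nonneg.2 hσ0.le
      positivity
    · filter_upwards [ae_restrict_mem measurableSet_Ioo] with l hl
      have hσ2 : σ ^ 2 ≤ 1 := pow_le_one₀ hσ0.le hσ1.le
      have : 0 ≤ Real.pi ^ 2 - l * σ ^ 2 := by nlinarith [hl.1, hl.2]
      exact mul_nonneg (hilbertDensity_nonneg hl) (inv_nonneg.2 this)
    · exact (measurable_hilbertDensity.mul (by fun_prop)).aestronglyMeasurable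
  rw [← h, ← integral_complex_ofReal]
  push_cast
  rfl

theorem sin_mul_integral_hilbertDensity {s : ℂ} (hs : |s.re| < 1 / 2) :
    Complex.sin (Real.pi * s) * ∫ l in Set.Ioo 0 (Real.pi ^ 2), (hilbertDensity l : ℂ) *
      ((Real.pi : ℂ) ^ 2 - l * Complex.sin (Real.pi * s) ^ 2)⁻¹ = s / Real.pi := by
  have hU : IsOpen {s : ℂ | |s.re| < 1 / 2} := isOpen_lt (by fun_prop) continuous_const
  have h := AnalyticOnNhd.eqOn_of_preconnected_of_frequently_eq (𝕜 := ℂ)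
    (f := fun s : ℂ => Complex.sin (Real.pi * s) * ∫ l in Set.Ioo 0 (Real.pi ^ 2),
      (hilbertDensity l : ℂ) * ((Real.pi : ℂ) ^ 2 - l * Complex.sin (Real.pi * s) ^ 2)⁻¹)
    (g := fun s => s / Real.pi) (U := {s : ℂ | |s.re| < 1 / 2}) (z₀ := 0) ?_ ?_
    (isPreconnected_abs_re_lt _) (by simp) (frequently_ofReal_Ioo one_half_pos ?_)
  · exact h hs
  · refine DifferentiableOn.analyticOnNhd (fun s hs => ?_) hU
    refine DifferentiableAt.differentiableWithinAt (DifferentiableAt.mul (by fun_prop) ?_)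
    exact DifferentiableAt.fun_comp' s (f := fun s : ℂ => Complex.sin (Real.pi * s) ^ 2)
      (differentiableAt_integral_hilbertDensity fun l hl => pi_sq_sub_mul_sin_sq_ne_zero hs hl)
      (by fun_prop)
  · exact fun s _ => by fun_prop
  · intro x hx0 hx1
    have hp := Real.pi_pos
    have hx : Real.pi * x < Real.pi / 2 := by nlinarith
    have hs0 : 0 < Real.sin (Real.pi * x) := Real.sin_pos_of_pos_of_lt_pi (by positivity)
      (by linarith)
    have hs1 : Real.sin (Real.pi * x) < 1 := by
      rw [← Real.sin_pi_div_two]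
      exact Real.sin_lt_sin_of_lt_of_le_pi_div_two (by nlinarith) le_rfl hx
    have hsin : Complex.sin (Real.pi * x) = (Real.sin (Real.pi * x) : ℝ) := by push_cast; rfl
    simp only [hsin]
    rw [integral_hilbertDensity_div hs0 hs1, Real.arcsin_sin (by nlinarith) hx.le]
    norm_cast
    field_simp

theorem inner_inverse_hilbert_sq_eq_integral {Γ : ℓ2 →L[ℂ] ℓ2}
    (hΓ : IsHankelOp (fun n => 1 / (n + 1)) Γ)
    (hinv : ∀ z : ℂ, (∀ t : ℝ, t ∈ Set.Icc (0 : ℝ) (Real.pi ^ 2) → z ≠ (t : ℂ)) →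
      IsUnit (Γ ^ 2 - z • (1 : ℓ2 →L[ℂ] ℓ2))) {z : ℂ}
    (hz : ∀ t : ℝ, t ∈ Set.Icc (0 : ℝ) (Real.pi ^ 2) → z ≠ (t : ℂ)) :
    ⟪e 0, (Ring.inverse (Γ ^ 2 - z • 1) : ℓ2 →L[ℂ] ℓ2) (e 0)⟫ =
      ∫ l in Set.Ioo (0 : ℝ) (Real.pi ^ 2),
        (1 / ((l : ℂ) - z)) * ((1 / (Real.pi ^ 2 * Real.sqrt l) : ℝ) : ℂ) *
          ((Real.log (Real.pi / Real.sqrt l +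
            Real.sqrt (Real.pi ^ 2 / l - 1)) : ℝ) : ℂ) := by
  obtain ⟨s, hs, h0, rfl⟩ := exists_sin_parametrization hz
  rw [inner_inverse_hilbert_sq_sub hΓ hinv hs h0]
  have h := sin_mul_integral_hilbertDensity hs
  have hi : ∀ l : ℝ, l ∈ Set.Ioo 0 (Real.pi ^ 2) →
      (1 / ((l : ℂ) - (Real.pi / Complex.sin (Real.pi * s)) ^ 2)) *
        ((1 / (Real.pi ^ 2 * Real.sqrt l) : ℝ) : ℂ) *
          ((Real.log (Real.pi / Real.sqrt l + Real.sqrt (Real.pi ^ 2 / l - 1)) : ℝ) : ℂ) =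
      -Complex.sin (Real.pi * s) ^ 2 * ((hilbertDensity l : ℂ) *
        ((Real.pi : ℂ) ^ 2 - l * Complex.sin (Real.pi * s) ^ 2)⁻¹) := by
    intro l hl
    have h1 := pi_sq_sub_mul_sin_sq_ne_zero hs ⟨hl.1.le, hl.2.le⟩
    have h2 : (l : ℂ) - (Real.pi / Complex.sin (Real.pi * s)) ^ 2 =
        -((Real.pi : ℂ) ^ 2 - l * Complex.sin (Real.pi * s) ^ 2) /
          Complex.sin (Real.pi * s) ^ 2 := by
      field_simp
      ring
    rw [h2, mul_assoc, ← Complex.ofReal_mul, ← hilbertDensity, one_div_div, div_neg,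
      div_eq_mul_inv]
    ring
  rw [setIntegral_congr_fun measurableSet_Ioo hi, integral_const_mul]
  linear_combination Complex.sin (Real.pi * s) * h

theorem statement19 (Γ : ℓ2 →L[ℂ] ℓ2)
    (hΓ : IsHankelOp (fun n => 1 / (n + 1)) Γ)
    (hinv : ∀ z : ℂ, (∀ t : ℝ, t ∈ Set.Icc (0 : ℝ) (Real.pi ^ 2) → z ≠ (t : ℂ)) →
      IsUnit (Γ ^ 2 - z • (1 : ℓ2 →L[ℂ] ℓ2))) :
    (∀ z : ℂ, (∀ t : ℝ, t ∈ Set.Icc (0 : ℝ) (Real.pi ^ 2) → z ≠ (t : ℂ)) →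
      ⟪e 0, (Ring.inverse (Γ ^ 2 - z • 1) : ℓ2 →L[ℂ] ℓ2) (e 0)⟫ =
        ∫ l in Set.Ioo (0 : ℝ) (Real.pi ^ 2),
          (1 / ((l : ℂ) - z)) * ((1 / (Real.pi ^ 2 * Real.sqrt l) : ℝ) : ℂ) *
            ((Real.log (Real.pi / Real.sqrt l +
              Real.sqrt (Real.pi ^ 2 / l - 1)) : ℝ) : ℂ)) ∧
    ∀ z : ℂ, (∀ t : ℝ, 0 ≤ t → z ≠ (t : ℂ)) →
      -z * ⟪e 0, (Ring.inverse (Γ ^ 2 - z • 1) : ℓ2 →L[ℂ] ℓ2) (e 0)⟫ =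
        Complex.log ((Real.pi : ℂ) / (-z) ^ (1 / 2 : ℂ) +
            (((Real.pi : ℂ) / (-z) ^ (1 / 2 : ℂ)) ^ 2 + 1) ^ (1 / 2 : ℂ)) /
          ((Real.pi : ℂ) / (-z) ^ (1 / 2 : ℂ)) := by
  exact ⟨fun z hz => inner_inverse_hilbert_sq_eq_integral hΓ hinv hz,
    fun z hz => neg_mul_inner_inverse_hilbert_sq hΓ hinv hz⟩
end
end
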